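/- arXiv:1809.10148 — 5 statements merged into one kernel-verified Lean document; each statement's English description precedes it below -/
import Mathlib

section
/- Let N be a positive integer and C : ZMod N → ℂ a function with Σ_{x ∈ ZMod N} C x = 0. Then for every natural number K, as t → 0⁺ one has Σ_{n=1}^∞ C(n mod N) · e^{−n t} − Σ_{ℓ=0}^{K−1} L(−ℓ, C) · (−t)^ℓ/ℓ! = O(t^K); that is, the function t ↦ Σ_{n≥1} C(n) e^{−nt} admits the asymptotic expansion Σ_{ℓ≥0} L(−ℓ, C) (−t)^ℓ/ℓ! at t = 0⁺. (The series Σ_{n≥1} C(n) e^{−nt} converges absolutely for every t > 0.) -/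
open Complex Topology Filter

/-- The sum of a function on `ZMod N` over a full period, shifted by one. -/
theorem ZMod.sum_range_add_one {N : ℕ} [NeZero N] {M : Type*} [AddCommMonoid M]
    (C : ZMod N → M) :
    ∑ i ∈ Finset.range N, C ((i + 1 : ℕ) : ZMod N) = ∑ x, C x := by
  rw [← Equiv.sum_comp (Equiv.addRight (1 : ZMod N)) C]
  refine Finset.sum_nbij' (fun i ↦ (i : ZMod N)) ZMod.val ?_ ?_ ?_ ?_ ?_
  · simp
  · simp [ZMod.val_lt]
  · intro i hi
    exact ZMod.val_cast_of_lt (Finset.mem_range.mp hi)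
  · simp
  · simp

/-- A function on `ZMod N` is bounded. -/
theorem ZMod.exists_norm_le {N : ℕ} [NeZero N] (C : ZMod N → ℂ) :
    ∃ M, ∀ x, ‖C x‖ ≤ M :=
  ⟨∑ x, ‖C x‖, fun x ↦
    Finset.single_le_sum (f := fun x ↦ ‖C x‖) (fun _ _ ↦ norm_nonneg _) (Finset.mem_univ x)⟩

/-- The generating function of a periodic sequence converges absolutely in the unit disc. -/
theorem ZMod.summable_norm_mul_pow {N : ℕ} [NeZero N] (C : ZMod N → ℂ) {u : ℂ} (hu : ‖u‖ < 1) :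
    Summable fun n : ℕ ↦ ‖C ((n + 1 : ℕ) : ZMod N) * u ^ n‖ := by
  obtain ⟨M, hM⟩ := ZMod.exists_norm_le C
  refine .of_nonneg_of_le (fun _ ↦ norm_nonneg _) (fun n ↦ ?_)
    ((summable_geometric_of_lt_one (norm_nonneg u) hu).mul_left M)
  rw [norm_mul, norm_pow]
  gcongr
  exact hM _

/-- The generating function of a periodic sequence with vanishing sum over a period is a rational
function without pole at `1`. -/
theorem ZMod.exists_polynomial_hasSum {N : ℕ} [NeZero N] {C : ZMod N → ℂ}
    (hC : ∑ x, C x = 0) :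
    ∃ q : Polynomial ℂ, ∀ u : ℂ, ‖u‖ < 1 → ∑ i ∈ Finset.range N, u ^ i ≠ 0 →
      HasSum (fun n : ℕ ↦ C ((n + 1 : ℕ) : ZMod N) * u ^ n)
        (q.eval u / ∑ i ∈ Finset.range N, u ^ i) := by
  let p : Polynomial ℂ := ∑ i ∈ Finset.range N, .C (C ((i + 1 : ℕ) : ZMod N)) * .X ^ i
  have hp (u : ℂ) : p.eval u = ∑ i ∈ Finset.range N, C ((i + 1 : ℕ) : ZMod N) * u ^ i := by
    simp [p, Polynomial.eval_finsetSum]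
  have hroot : p.IsRoot 1 := by
    simpa only [Polynomial.IsRoot, hp, one_pow, mul_one, ZMod.sum_range_add_one] using hC
  obtain ⟨q, hq⟩ := Polynomial.dvd_iff_isRoot.mpr hroot
  refine ⟨-q, fun u hu hg ↦ ?_⟩
  have hs := (ZMod.summable_norm_mul_pow C hu).of_norm
  have hshift := hs.sum_add_tsum_nat_add N
  have hperiod (n : ℕ) : C ((n + N + 1 : ℕ) : ZMod N) * u ^ (n + N) =
      u ^ N * (C ((n + 1 : ℕ) : ZMod N) * u ^ n) := by
    push_cast
    rw [ZMod.natCast_self, add_zero]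
    ring
  simp_rw [hperiod, tsum_mul_left] at hshift
  rw [← hp, hq, Polynomial.eval_mul] at hshift
  have hu1 : u - 1 ≠ 0 := sub_ne_zero.mpr fun h ↦ by simp [h] at hu
  convert! hs.hasSum
  rw [div_eq_iff hg]
  apply mul_left_cancel₀ hu1
  have hgeom := geom_sum_mul u N
  simp only [Polynomial.eval_sub, Polynomial.eval_X, Polynomial.eval_C, Polynomial.eval_neg]
    at hshift ⊢
  linear_combination (-1 : ℂ) * hshift -
    (∑' n : ℕ, C ((n + 1 : ℕ) : ZMod N) * u ^ n) * hgeom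

/-- Truncated Taylor expansion of `z ^ ℓ * exp (-z)`, written with the values of the rising
factorial at nonpositive integers. -/
theorem pow_mul_exp_neg_sub_isBigO {ℓ K : ℕ} (h : ℓ ≤ K) :
    (fun z : ℂ ↦ z ^ ℓ * exp (-z) -
      ∑ m ∈ Finset.range K, (ascPochhammer ℂ ℓ).eval (-(m : ℂ)) * (-z) ^ m / m.factorial)
      =O[𝓝 0] fun z ↦ z ^ K := by
  obtain ⟨d, rfl⟩ := Nat.exists_eq_add_of_le h
  have h1 := (Complex.exp_sub_sum_range_isBigO_pow d).comp_tendsto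
    (show Tendsto (fun z : ℂ ↦ -z) (𝓝 0) (𝓝 0) by simpa using (continuous_neg (G := ℂ)).tendsto 0)
  have h2 : (fun z : ℂ ↦ (-z) ^ d) =O[𝓝 0] fun z ↦ z ^ d :=
    .of_bound 1 (by simp)
  refine ((Asymptotics.isBigO_refl (fun z : ℂ ↦ z ^ ℓ) _).mul (h1.trans h2)).congr
    (fun z ↦ ?_) (fun z ↦ (pow_add z ℓ d).symm)
  rw [Finset.sum_range_add, Finset.sum_eq_zero, zero_add, Function.comp_apply, mul_sub,
    Finset.mul_sum]
  · congr 1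
    refine Finset.sum_congr rfl fun j _ ↦ ?_
    rw [ascPochhammer_eval_neg_eq_descPochhammer, descPochhammer_eval_eq_descFactorial,
      ← Nat.factorial_mul_descFactorial (Nat.le_add_right ℓ j), Nat.add_sub_cancel_left]
    have hd : ((ℓ + j).descFactorial ℓ : ℂ) ≠ 0 := by
      simp [Nat.descFactorial_eq_zero_iff_lt]
    have := j.factorial_ne_zero
    push_cast
    field_simp
    rw [pow_add, neg_pow z ℓ]
    have hsq : (-1 : ℂ) ^ ℓ * (-1) ^ ℓ = 1 := by rw [← mul_pow]; simp
    linear_combination (-(z ^ ℓ * (-z) ^ j)) * hsq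
  · intro m hm
    rw [ascPochhammer_eval_neg_coe_nat_of_lt (Finset.mem_range.mp hm)]
    simp

/-- The Mellin transform of `t ^ ℓ * exp (-t)` is `Γ(s + ℓ)`, written as a multiple of `Γ(s)`. -/
theorem hasMellin_pow_mul_exp_neg (ℓ : ℕ) {s : ℂ} (hs : 0 < s.re) :
    HasMellin (fun t : ℝ ↦ (t : ℂ) ^ ℓ * exp (-t)) s
      ((ascPochhammer ℂ ℓ).eval s * Gamma s) := by
  have hs' : 0 < (s + ℓ).re := by simp; positivity
  have hint (t : ℝ) (ht : t ∈ Set.Ioi 0) : ((-t).exp * t ^ (s + ℓ - 1) : ℂ) =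
      (t : ℂ) ^ (s - 1) • ((t : ℂ) ^ ℓ * exp (-t)) := by
    have ht0 : (t : ℂ) ≠ 0 := ofReal_ne_zero.mpr (ne_of_gt ht)
    rw [show s + ℓ - 1 = s - 1 + ℓ by ring, cpow_add _ _ ht0, cpow_natCast, smul_eq_mul]
    push_cast
    ring
  constructor
  · exact (GammaIntegral_convergent hs').congr_fun (fun t ht ↦ by
      simpa using hint t ht) measurableSet_Ioi
  · have hn (k : ℕ) : s ≠ -k := by
      rintro rfl
      simp at hs
      linarith [(Nat.cast_nonneg k : (0 : ℝ) ≤ k)]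
    rw [← Gamma_add_nat_div_Gamma_eq s hn, div_mul_cancel₀ _ (Gamma_ne_zero hn),
      Gamma_eq_integral hs', GammaIntegral, mellin]
    exact (MeasureTheory.setIntegral_congr_fun measurableSet_Ioi fun t ht ↦ by
      simpa using hint t ht).symm

/-- The exponential series of a periodic sequence has Mellin transform `Γ(s) L(s, C)`. -/
theorem ZMod.mellin_eq_Gamma_mul_LFunction {N : ℕ} [NeZero N] (C : ZMod N → ℂ) {F : ℝ → ℂ}
    (hF : ∀ t : ℝ, 0 < t → HasSum
      (fun n : ℕ ↦ C ((n + 1 : ℕ) : ZMod N) * (Real.exp (-((n : ℝ) + 1) * t) : ℂ)) (F t))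
    {s : ℂ} (hs : 1 < s.re) :
    mellin F s = Gamma s * ZMod.LFunction C s := by
  have hsum := ZMod.LSeriesSummable_of_one_lt_re C hs
  have hterm (n : ℕ) : LSeries.term (fun k : ℕ ↦ C k) s (n + 1) =
      C ((n + 1 : ℕ) : ZMod N) / (((n : ℝ) + 1 : ℝ) : ℂ) ^ s := by
    rw [LSeries.term_of_ne_zero n.succ_ne_zero]
    push_cast
    rfl
  have h := hasSum_mellin (F := F) (p := fun n : ℕ ↦ (n : ℝ) + 1) (s := s)
    (fun n ↦ .inr (by positivity)) (by linarith) hF (by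
      refine ((summable_nat_add_iff 1).mpr hsum.norm).congr fun n ↦ ?_
      rw [hterm, norm_div, norm_cpow_eq_rpow_re_of_pos (by positivity)])
  rw [← h.tsum_eq, ZMod.LFunction_eq_LSeries C hs, LSeries, hsum.tsum_eq_zero_add,
    LSeries.term_zero, zero_add, ← tsum_mul_left]
  simp_rw [hterm, mul_div_assoc]

/-- If the exponential series of `C` is a combination of the functions `t ^ ℓ * exp (-t)`, `ℓ < K`,
up to an exponentially decaying error that is `O(t ^ K)` at `0`, then the coefficients determine
`L(-m, C)` for `m < K`. -/
theorem ZMod.LFunction_neg_nat_eq_sum {N : ℕ} [NeZero N] {C : ZMod N → ℂ} (hC : ∑ x, C x = 0)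
    {F : ℝ → ℂ} (hF : ∀ t : ℝ, 0 < t → HasSum
      (fun n : ℕ ↦ C ((n + 1 : ℕ) : ZMod N) * (Real.exp (-((n : ℝ) + 1) * t) : ℂ)) (F t))
    {K : ℕ} {b : ℕ → ℂ} {R : ℝ → ℂ}
    (hFR : ∀ t, F t = R t + ∑ ℓ ∈ Finset.range K, b ℓ * ((t : ℂ) ^ ℓ * exp (-t)))
    (hcont : ContinuousOn R (Set.Ioi 0)) {a : ℝ} (ha : 0 < a)
    (htop : R =O[atTop] fun t ↦ Real.exp (-a * t))
    (hbot : R =O[𝓝[>] 0] fun t ↦ t ^ K) {m : ℕ} (hm : m < K) :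
    ZMod.LFunction C (-(m : ℂ)) =
      ∑ ℓ ∈ Finset.range K, b ℓ * (ascPochhammer ℂ ℓ).eval (-(m : ℂ)) := by
  have hint := hcont.locallyIntegrableOn measurableSet_Ioi (μ := MeasureTheory.volume)
  have hbot' : R =O[𝓝[>] 0] (· ^ (-(-(K : ℝ)))) := by simpa using hbot
  let A (s : ℂ) : ℂ := ∑ ℓ ∈ Finset.range K, b ℓ * (ascPochhammer ℂ ℓ).eval s +
    mellin R s * (Gamma s)⁻¹
  have hU : IsOpen {s : ℂ | -(K : ℝ) < s.re} := isOpen_lt continuous_const continuous_re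
  have hA : AnalyticOnNhd ℂ A {s : ℂ | -(K : ℝ) < s.re} := by
    refine DifferentiableOn.analyticOnNhd (fun s hs ↦ ?_) hU
    refine (DifferentiableAt.add (by fun_prop) ?_).differentiableWithinAt
    exact (mellin_differentiableAt_of_isBigO_rpow_exp ha hint htop hbot' hs).mul
      (differentiable_one_div_Gamma s)
  have hL : AnalyticOnNhd ℂ (ZMod.LFunction C) {s : ℂ | -(K : ℝ) < s.re} :=
    (ZMod.differentiable_LFunction_of_sum_zero hC).differentiableOn.analyticOnNhd hU
  have hEq : ZMod.LFunction C =ᶠ[𝓝 2] A := by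
    filter_upwards [(isOpen_lt continuous_const continuous_re).mem_nhds
      (show (2 : ℂ) ∈ {s : ℂ | 1 < s.re} by simp)] with s hs
    have hs0 : 0 < s.re := zero_lt_one.trans hs
    have hΓ : Gamma s ≠ 0 := Gamma_ne_zero_of_re_pos hs0
    have hR : MellinConvergent R s := mellinConvergent_of_isBigO_rpow_exp ha hint htop hbot'
      (lt_of_le_of_lt (by simp) hs0)
    have hpoly (ℓ : ℕ) : HasMellin (fun t : ℝ ↦ b ℓ * ((t : ℂ) ^ ℓ * exp (-t))) s
        (b ℓ * ((ascPochhammer ℂ ℓ).eval s * Gamma s)) := by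
      have h := hasMellin_pow_mul_exp_neg ℓ hs0
      simpa only [smul_eq_mul, h.2] using hasMellin_const_smul h.1 (b ℓ)
    have hsum : ∀ k : ℕ, HasMellin
        (fun t : ℝ ↦ ∑ ℓ ∈ Finset.range k, b ℓ * ((t : ℂ) ^ ℓ * exp (-t))) s
        (∑ ℓ ∈ Finset.range k, b ℓ * ((ascPochhammer ℂ ℓ).eval s * Gamma s)) := by
      intro k
      induction k with
      | zero => simp [HasMellin, MellinConvergent, mellin]
      | succ k ih =>
        simp_rw [Finset.sum_range_succ]
        simpa only [ih.2, (hpoly k).2] using hasMellin_add ih.1 (hpoly k).1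
    have h := (hasMellin_add hR (hsum K).1).2
    simp_rw [← hFR, (hsum K).2] at h
    rw [ZMod.mellin_eq_Gamma_mul_LFunction C hF hs] at h
    apply mul_left_cancel₀ hΓ
    rw [h]
    simp only [A]
    rw [mul_add, mul_left_comm, mul_inv_cancel₀ hΓ, mul_one, add_comm, Finset.mul_sum]
    congr 1
    exact Finset.sum_congr rfl fun ℓ _ ↦ by ring
  have hmem : -(m : ℂ) ∈ {s : ℂ | -(K : ℝ) < s.re} := by simpa using hm
  have := hL.eqOn_of_preconnected_of_eventuallyEq hA
    (convex_halfSpace_re_gt _).isPreconnected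
    (show (2 : ℂ) ∈ {s : ℂ | -(K : ℝ) < s.re} from
      lt_of_le_of_lt (by simp) (zero_lt_two (α := ℝ))) hEq hmem
  simpa [A, Gamma_neg_nat_eq_zero] using this

/-- Taylor's formula at `0` for an analytic function of one complex variable. -/
theorem AnalyticAt.exists_isBigO_sub_sum {G : ℂ → ℂ} (hG : AnalyticAt ℂ G 0) :
    ∃ b : ℕ → ℂ, ∀ K : ℕ,
      (fun z ↦ G z - ∑ ℓ ∈ Finset.range K, b ℓ * z ^ ℓ) =O[𝓝 0] fun z ↦ z ^ K := by
  obtain ⟨p, hp⟩ := hG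
  refine ⟨p.coeff, fun K ↦ ?_⟩
  refine ((hp.isBigO_sub_partialSum_pow K).congr (fun z ↦ ?_)
    fun z ↦ (norm_pow z K).symm).of_norm_right
  simp [FormalMultilinearSeries.partialSum, mul_comm]

/-- Lawrence–Zagier asymptotic expansion. If `Σ_x C x = 0` then
`Σ_{n≥1} C(n) e^{−nt}` has the asymptotic expansion `Σ_ℓ L(−ℓ, C)·(−t)^ℓ/ℓ!`
as `t → 0⁺`. -/
theorem lawrenceZagier_asymptotic_linear (N : ℕ) [NeZero N]
    (C : ZMod N → ℂ) (hC : ∑ x : ZMod N, C x = 0) (K : ℕ) :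
    (∀ t : ℝ, 0 < t →
      Summable fun n : ℕ =>
        ‖C ((n + 1 : ℕ) : ZMod N) * (Real.exp (-((n : ℝ) + 1) * t) : ℂ)‖) ∧
    Asymptotics.IsBigO (𝓝[>] (0 : ℝ))
      (fun t : ℝ =>
        (∑' n : ℕ, C ((n + 1 : ℕ) : ZMod N) * (Real.exp (-((n : ℝ) + 1) * t) : ℂ)) -
          ∑ ℓ ∈ Finset.range K,
            ZMod.LFunction C (-(ℓ : ℂ)) * (-(t : ℂ)) ^ ℓ / (ℓ.factorial : ℂ))
      (fun t : ℝ => t ^ K) := by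
  have hexp (t : ℝ) (n : ℕ) :
      C ((n + 1 : ℕ) : ZMod N) * (Real.exp (-((n : ℝ) + 1) * t) : ℂ) =
        exp (-t) * (C ((n + 1 : ℕ) : ZMod N) * exp (-t) ^ n) := by
    push_cast
    rw [mul_left_comm, ← Complex.exp_nat_mul, ← Complex.exp_add]
    ring_nf
  have hlt (t : ℝ) (ht : 0 < t) : ‖exp (-(t : ℂ))‖ < 1 := by simpa [Complex.norm_exp] using ht
  obtain ⟨q, hq⟩ := ZMod.exists_polynomial_hasSum hC
  let h (u : ℂ) : ℂ := q.eval u / ∑ i ∈ Finset.range N, u ^ i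
  have hgeom (x : ℝ) (hx : 0 ≤ x) : ∑ i ∈ Finset.range N, (x : ℂ) ^ i ≠ 0 := by
    have := geom_sum_pos hx (NeZero.ne N)
    exact_mod_cast this.ne'
  have hcont (x : ℝ) (hx : 0 ≤ x) : AnalyticAt ℂ h x :=
    .div (q.differentiable.analyticAt _) (by fun_prop) (hgeom x hx)
  have hF (t : ℝ) (ht : 0 < t) : HasSum
      (fun n : ℕ ↦ C ((n + 1 : ℕ) : ZMod N) * (Real.exp (-((n : ℝ) + 1) * t) : ℂ))
      (exp (-t) * h (exp (-t))) := by
    simp_rw [hexp]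
    refine (hq _ (hlt t ht) ?_).mul_left _
    simpa using hgeom (Real.exp (-t)) (Real.exp_pos _).le
  have hG : AnalyticAt ℂ (fun z ↦ h (exp (-z))) 0 := by
    refine AnalyticAt.fun_comp ?_ (by fun_prop)
    simpa using hcont 1 zero_le_one
  obtain ⟨b, hb⟩ := hG.exists_isBigO_sub_sum
  have hofReal : Tendsto (fun t : ℝ ↦ (t : ℂ)) (𝓝[>] 0) (𝓝 0) := by
    simpa using (continuous_ofReal.tendsto 0).mono_left nhdsWithin_le_nhds
  have hpow : (fun t : ℝ ↦ (t : ℂ) ^ K) =O[𝓝[>] 0] fun t : ℝ ↦ t ^ K :=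
    .of_bound 1 (by simp)
  let R (t : ℝ) : ℂ := exp (-t) * (h (exp (-t)) - ∑ ℓ ∈ Finset.range K, b ℓ * (t : ℂ) ^ ℓ)
  have hRbot : R =O[𝓝[>] 0] fun t ↦ t ^ K := by
    have h1 : (fun t : ℝ ↦ exp (-(t : ℂ))) =O[𝓝[>] 0] fun _ ↦ (1 : ℝ) := by
      refine Tendsto.isBigO_one ℝ (c := exp (-0)) ?_
      exact (continuous_exp.comp continuous_neg).tendsto 0 |>.comp hofReal
    simpa using h1.mul (((hb K).comp_tendsto hofReal).trans hpow)
  have hRcont : ContinuousOn R (Set.Ioi 0) := by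
    refine Continuous.continuousOn ?_
    refine .mul (by fun_prop) (.sub ?_ (by fun_prop))
    refine continuous_iff_continuousAt.mpr fun t ↦ ?_
    refine ContinuousAt.comp (g := h) (f := fun t : ℝ ↦ exp (-(t : ℂ))) ?_ (by fun_prop)
    simpa using (hcont (Real.exp (-t)) (Real.exp_pos _).le).continuousAt
  have hRtop : R =O[atTop] fun t ↦ Real.exp (-(1 / 2) * t) := by
    have hbdd : (fun t : ℝ ↦ h (exp (-t))) =O[atTop] fun t ↦ Real.exp (1 / 2 * t) := by
      have hlim : Tendsto (fun t : ℝ ↦ exp (-(t : ℂ))) atTop (𝓝 ((0 : ℝ) : ℂ)) := by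
        simpa [Function.comp_def] using
          (continuous_ofReal.tendsto 0).comp Real.tendsto_exp_neg_atTop_nhds_zero
      refine (((hcont 0 le_rfl).continuousAt.tendsto.comp hlim).isBigO_one ℝ).trans ?_
      refine .of_bound 1 ?_
      filter_upwards [eventually_ge_atTop 0] with t ht
      simpa using ht
    have hpoly : (fun t : ℝ ↦ ∑ ℓ ∈ Finset.range K, b ℓ * (t : ℂ) ^ ℓ) =O[atTop]
        fun t ↦ Real.exp (1 / 2 * t) := by
      refine .fun_sum fun ℓ _ ↦ .const_mul_left ?_ _
      refine .trans (.of_bound 1 (by simp))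
        (isLittleO_pow_exp_pos_mul_atTop (k := ℓ) (b := 1 / 2) (by norm_num)).isBigO
    have h1 : (fun t : ℝ ↦ exp (-(t : ℂ))) =O[atTop] fun t ↦ Real.exp (-t) :=
      .of_bound 1 (by simp [Complex.norm_exp])
    refine (h1.mul (hbdd.sub hpoly)).congr_right fun t ↦ ?_
    rw [← Real.exp_add]
    ring_nf
  have hFR (t : ℝ) : exp (-t) * h (exp (-t)) =
      R t + ∑ ℓ ∈ Finset.range K, b ℓ * ((t : ℂ) ^ ℓ * exp (-t)) := by
    simp only [R, mul_sub, Finset.mul_sum]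
    rw [sub_add, sub_eq_self.mpr]
    exact sub_eq_zero.mpr <| Finset.sum_congr rfl fun ℓ _ ↦ by ring
  refine ⟨fun t ht ↦ ?_, ?_⟩
  · simp_rw [hexp, norm_mul (exp (-(t : ℂ)))]
    exact (ZMod.summable_norm_mul_pow C (hlt t ht)).mul_left _
  · have hexpand : (fun t : ℝ ↦ ∑ ℓ ∈ Finset.range K, b ℓ * ((t : ℂ) ^ ℓ * exp (-t) -
        ∑ m ∈ Finset.range K,
          (ascPochhammer ℂ ℓ).eval (-(m : ℂ)) * (-(t : ℂ)) ^ m / m.factorial))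
        =O[𝓝[>] 0] fun t ↦ t ^ K :=
      .fun_sum fun ℓ hℓ ↦ .const_mul_left
        (((pow_mul_exp_neg_sub_isBigO (Finset.mem_range.mp hℓ).le).comp_tendsto hofReal).trans
          hpow) _
    refine (hRbot.add hexpand).congr' ?_ .rfl
    filter_upwards [self_mem_nhdsWithin] with t ht
    rw [(hF t ht).tsum_eq, hFR t]
    simp_rw [mul_sub, Finset.sum_sub_distrib]
    rw [add_sub_assoc]
    congr 2
    simp_rw [Finset.mul_sum]
    rw [Finset.sum_comm]
    refine Finset.sum_congr rfl fun m hm ↦ ?_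
    rw [ZMod.LFunction_neg_nat_eq_sum hC hF hFR hRcont one_half_pos hRtop hRbot
      (Finset.mem_range.mp hm), Finset.sum_mul, Finset.sum_div]
    exact Finset.sum_congr rfl fun ℓ _ ↦ by ring
end

section
/- Let N be a positive integer and C : ZMod N → ℂ a function with Σ_{x ∈ ZMod N} C x = 0. Then for every natural number K, as t → 0⁺ one has Σ_{n=1}^∞ C(n mod N) · e^{−n² t} − Σ_{ℓ=0}^{K−1} L(−2ℓ, C) · (−t)^ℓ/ℓ! = O(t^K); that is, the function t ↦ Σ_{n≥1} C(n) e^{−n²t} admits the asymptotic expansion Σ_{ℓ≥0} L(−2ℓ, C) (−t)^ℓ/ℓ! at t = 0⁺. -/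
open Complex Topology Filter

/-- A function with mean zero on `[0, 1]` is bounded there by any bound for its derivative. -/
lemma abs_le_of_integral_eq_zero_of_abs_deriv_le {F F' : ℝ → ℝ} {B : ℝ}
    (hF : ∀ x, HasDerivAt F (F' x) x) (hint : ∫ y in (0 : ℝ)..1, F y = 0)
    (hB : ∀ x ∈ Set.Icc (0 : ℝ) 1, |F' x| ≤ B) {x : ℝ} (hx : x ∈ Set.Icc (0 : ℝ) 1) :
    |F x| ≤ B := by
  have hB0 : 0 ≤ B := (abs_nonneg _).trans (hB x hx)
  have hcont : Continuous F := continuous_iff_continuousAt.2 fun y => (hF y).continuousAt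
  have key : F x = ∫ y in (0 : ℝ)..1, (F x - F y) := by
    rw [intervalIntegral.integral_sub (by simp) (hcont.intervalIntegrable _ _), hint]
    simp
  rw [key, ← Real.norm_eq_abs]
  refine (intervalIntegral.norm_integral_le_of_norm_le_const (C := B) fun y hy => ?_).trans
    (by simp)
  rw [Set.uIoc_of_le zero_le_one] at hy
  have hy' : y ∈ Set.Icc (0 : ℝ) 1 := ⟨hy.1.le, hy.2⟩
  refine ((convex_Icc (0 : ℝ) 1).norm_image_sub_le_of_norm_hasDerivWithin_le
    (fun z _ => (hF z).hasDerivWithinAt) hB hy' hx).trans ?_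
  have : |x - y| ≤ 1 := abs_le.2 ⟨by linarith [hx.1, hy'.2], by linarith [hx.2, hy'.1]⟩
  exact mul_le_of_le_one_right hB0 this

/-- The remainder in the Euler–Maclaurin formula of order `K` on `[0, 1]`, shifted by `x`,
where `g k` is the `k`-th derivative of the summand. -/
noncomputable def eulerMaclaurinRemainder (g : ℕ → ℝ → ℝ) (K : ℕ) (x : ℝ) : ℝ :=
  g 0 x - (∫ y in (0 : ℝ)..1, g 0 y) -
    ∑ k ∈ Finset.range K, bernoulliFun (k + 1) x / (k + 1).factorial * (g k 1 - g k 0)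

lemma integral_eulerMaclaurinRemainder {g : ℕ → ℝ → ℝ} (h0 : Continuous (g 0)) (K : ℕ) :
    ∫ y in (0 : ℝ)..1, eulerMaclaurinRemainder g K y = 0 := by
  unfold eulerMaclaurinRemainder
  rw [intervalIntegral.integral_sub (Continuous.intervalIntegrable (by fun_prop) _ _)
      (Continuous.intervalIntegrable (by fun_prop) _ _),
    intervalIntegral.integral_sub (Continuous.intervalIntegrable (by fun_prop) _ _)
      (Continuous.intervalIntegrable (by fun_prop) _ _),
    intervalIntegral.integral_finsetSum
      (fun i _ => Continuous.intervalIntegrable (by fun_prop) _ _)]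
  simp [integral_bernoulliFun]

lemma abs_eulerMaclaurinRemainder_le {g : ℕ → ℝ → ℝ}
    (hg : ∀ k x, HasDerivAt (g k) (g (k + 1) x) x) {K : ℕ} {B : ℝ}
    (hB : ∀ x ∈ Set.Icc (0 : ℝ) 1, |g (K + 1) x| ≤ B) {x : ℝ} (hx : x ∈ Set.Icc (0 : ℝ) 1) :
    |eulerMaclaurinRemainder g K x| ≤ B := by
  have hcont (k : ℕ) : Continuous (g k) :=
    continuous_iff_continuousAt.2 fun y => (hg k y).continuousAt
  induction K generalizing g x with
  | zero =>
    refine abs_le_of_integral_eq_zero_of_abs_deriv_le (F' := g 1) (fun y => ?_)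
      (integral_eulerMaclaurinRemainder (hcont 0) 0) hB hx
    simpa +unfoldPartialApp [eulerMaclaurinRemainder] using
      (hg 0 y).sub_const (∫ y in (0 : ℝ)..1, g 0 y)
  | succ K ih =>
    refine abs_le_of_integral_eq_zero_of_abs_deriv_le
      (F' := eulerMaclaurinRemainder (fun k => g (k + 1)) K) (fun y => ?_)
      (integral_eulerMaclaurinRemainder (hcont 0) _) (fun y hy => ?_) hx
    · have hsum : HasDerivAt (fun y => ∑ k ∈ Finset.range (K + 1),
          bernoulliFun (k + 1) y / (k + 1).factorial * (g k 1 - g k 0))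
          (∑ k ∈ Finset.range (K + 1), bernoulliFun k y / k.factorial * (g k 1 - g k 0)) y := by
        refine HasDerivAt.fun_sum fun k _ => ?_
        convert! ((hasDerivAt_bernoulliFun (k + 1) y).div_const _).mul_const _ using 2
        rw [Nat.factorial_succ, Nat.cast_mul, Nat.add_sub_cancel]
        exact (mul_div_mul_left _ _ (by positivity)).symm
      convert! ((hg 0 y).sub_const _).sub hsum using 1
      rw [eulerMaclaurinRemainder, Finset.sum_range_succ',
        intervalIntegral.integral_eq_sub_of_hasDerivAt (fun z _ => hg 0 z)
          ((hcont 1).intervalIntegrable _ _)]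
      simp
      ring
    · exact ih (fun k => hg (k + 1)) hB hy fun k => hcont (k + 1)

/-- Euler–Maclaurin summation for a weighted combination, of total weight zero, of shifts of a
function all of whose derivatives `g k` are summable along the integers. -/
lemma norm_tsum_add_eulerMaclaurin_le {ι : Type*} [Fintype ι] {w : ι → ℂ} (hw : ∑ j, w j = 0)
    {x : ι → ℝ} (hx : ∀ j, x j ∈ Set.Icc (0 : ℝ) 1) {g : ℕ → ℝ → ℝ}
    (hg : ∀ k x, HasDerivAt (g k) (g (k + 1) x) x)
    (hsum : ∀ k, Summable fun m : ℕ => g k m) {K : ℕ} {b : ℕ → ℝ} (hb : Summable b)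
    (hgb : ∀ m : ℕ, ∀ y ∈ Set.Icc (0 : ℝ) 1, |g (K + 1) (m + y)| ≤ b m) :
    ‖∑' m : ℕ, ∑ j, w j * (g 0 (m + x j) : ℂ) + ∑ k ∈ Finset.range K,
        (∑ j, w j * (bernoulliFun (k + 1) (x j) / (k + 1).factorial : ℝ)) * (g k 0 : ℂ)‖ ≤
      (∑ j, ‖w j‖) * ∑' m, b m := by
  set β : ℕ → ℂ := fun k =>
    ∑ j, w j * (bernoulliFun (k + 1) (x j) / (k + 1).factorial : ℝ) with hβ
  set E : ℕ → ι → ℝ := fun m j => eulerMaclaurinRemainder (fun k y => g k (m + y)) K (x j) with hE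
  have hEb (m : ℕ) (j : ι) : |E m j| ≤ b m :=
    abs_eulerMaclaurinRemainder_le (fun k y => (hg k (m + y)).comp_const_add (m : ℝ) y) (hgb m)
      (hx j)
  have hterm (m : ℕ) : ∑ j, w j * (E m j : ℂ) = ∑ j, w j * (g 0 (m + x j) : ℂ) -
      ∑ k ∈ Finset.range K, β k * ((g k (m + 1 : ℕ) : ℂ) - (g k m : ℂ)) := by
    simp only [hE, eulerMaclaurinRemainder, ofReal_sub, mul_sub, Finset.sum_sub_distrib,
      ← Finset.sum_mul, hw, zero_mul, sub_zero, ofReal_sum, Finset.mul_sum, hβ]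
    rw [Finset.sum_comm]
    simp only [Finset.sum_mul]
    rw [← Finset.sum_sub_distrib]
    simp [mul_assoc]
    exact Finset.sum_comm

  have htel (k : ℕ) : HasSum (fun m : ℕ => (g k (m + 1 : ℕ) : ℂ) - (g k m : ℂ)) (-(g k 0 : ℂ)) := by
    have h : HasSum (fun m : ℕ => (g k m : ℂ)) ((∑' m : ℕ, g k m : ℝ) : ℂ) :=
      hasSum_ofReal.2 (hsum k).hasSum
    have h1 := (hasSum_nat_add_iff' 1).2 h
    convert! h1.sub h using 1
    simp
  have hbd (m : ℕ) : ‖∑ j, w j * (E m j : ℂ)‖ ≤ (∑ j, ‖w j‖) * b m := by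
    rw [Finset.sum_mul]
    refine norm_sum_le_of_le _ fun j _ => ?_
    rw [norm_mul, norm_real]
    exact mul_le_mul_of_nonneg_left (hEb m j) (norm_nonneg _)
  have hEs : Summable fun m => ∑ j, w j * (E m j : ℂ) :=
    Summable.of_norm_bounded (hb.mul_left _) hbd
  have htot : HasSum (fun m : ℕ => ∑ j, w j * (g 0 (m + x j) : ℂ))
      (∑' m, ∑ j, w j * (E m j : ℂ) + ∑ k ∈ Finset.range K, β k * (-(g k 0 : ℂ))) := by
    refine (hEs.hasSum.add (hasSum_sum fun k _ => (htel k).mul_left (β k))).congr_fun fun m => ?_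
    rw [hterm]; ring
  rw [htot.tsum_eq]
  simp only [mul_neg, Finset.sum_neg_distrib]
  rw [neg_add_cancel_right, ← tsum_mul_left]
  exact tsum_of_norm_bounded (hb.mul_left _).hasSum hbd

lemma exists_abs_eval_mul_exp_le (p : Polynomial ℝ) :
    ∃ M, ∀ y : ℝ, |p.eval y| * Real.exp (-(y ^ 2 / 2)) ≤ M := by
  induction p using Polynomial.induction_on' with
  | add p q hp hq =>
    obtain ⟨M, hM⟩ := hp
    obtain ⟨M', hM'⟩ := hq
    refine ⟨M + M', fun y => ?_⟩
    rw [Polynomial.eval_add]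
    nlinarith [hM y, hM' y, abs_add_le (p.eval y) (q.eval y), Real.exp_pos (-(y ^ 2 / 2))]
  | monomial n a =>
    refine ⟨|a| * (1 + 2 ^ n * n.factorial), fun y => ?_⟩
    have h1 : |y| ^ n ≤ 1 + (y ^ 2) ^ n := by
      rw [← sq_abs, ← pow_mul, mul_comm, pow_mul]
      nlinarith [sq_nonneg (|y| ^ n - 1), sq_nonneg (|y| ^ n)]
    have h2 := Real.pow_div_factorial_le_exp (y ^ 2 / 2) (by positivity) n
    rw [div_pow, div_div, div_le_iff₀ (by positivity)] at h2
    have h3 : Real.exp (-(y ^ 2 / 2)) ≤ 1 := Real.exp_le_one_iff.2 (by nlinarith [sq_nonneg y])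
    have h4 : Real.exp (y ^ 2 / 2) * Real.exp (-(y ^ 2 / 2)) = 1 := by
      rw [← Real.exp_add]; simp
    rw [Polynomial.eval_monomial, abs_mul, abs_pow, mul_assoc]
    refine mul_le_mul_of_nonneg_left ?_ (abs_nonneg a)
    calc |y| ^ n * Real.exp (-(y ^ 2 / 2))
        ≤ (1 + Real.exp (y ^ 2 / 2) * (2 ^ n * n.factorial)) * Real.exp (-(y ^ 2 / 2)) := by
          gcongr; linarith
      _ = Real.exp (-(y ^ 2 / 2)) + Real.exp (y ^ 2 / 2) * Real.exp (-(y ^ 2 / 2)) *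
          (2 ^ n * n.factorial) := by ring
      _ ≤ _ := by rw [h4]; linarith

/-- The `k`-th derivative of `x ↦ exp (-(c * x) ^ 2 / 2)`. -/
noncomputable def gaussianDeriv (c : ℝ) (k : ℕ) (x : ℝ) : ℝ :=
  (-c) ^ k * (Polynomial.aeval (c * x) (Polynomial.hermite k) * Real.exp (-((c * x) ^ 2 / 2)))

lemma gaussianDeriv_zero (c x : ℝ) : gaussianDeriv c 0 x = Real.exp (-((c * x) ^ 2 / 2)) := by
  simp [gaussianDeriv]

lemma gaussianDeriv_apply_zero (c : ℝ) (k : ℕ) :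
    gaussianDeriv c k 0 = (-c) ^ k * ((Polynomial.hermite k).coeff 0 : ℝ) := by
  simp [gaussianDeriv, Polynomial.aeval_def, Polynomial.eval₂_at_zero]

lemma gaussianDeriv_apply_zero_of_odd (c : ℝ) {k : ℕ} (hk : Odd k) : gaussianDeriv c k 0 = 0 := by
  rw [gaussianDeriv_apply_zero, Polynomial.coeff_hermite_of_odd_add (by simpa using hk)]
  simp

lemma hasDerivAt_gaussianDeriv (c : ℝ) (k : ℕ) (x : ℝ) :
    HasDerivAt (gaussianDeriv c k) (gaussianDeriv c (k + 1) x) x := by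
  have hlin : HasDerivAt (fun y => c * y) c x := by simpa using (hasDerivAt_id x).const_mul c
  have hp := ((Polynomial.hermite k).hasDerivAt_aeval (c * x)).comp x hlin
  have he := ((hlin.pow 2).div_const 2).neg.exp
  convert! (hp.mul he).const_mul ((-c) ^ k) using 1
  simp [gaussianDeriv, Polynomial.hermite_succ]
  ring

lemma exists_abs_gaussianDeriv_le (k : ℕ) :
    ∃ M, 0 ≤ M ∧ ∀ c ∈ Set.Ioc (0 : ℝ) 1, ∀ x y : ℝ, 0 ≤ x → x ≤ y →
      |gaussianDeriv c k y| ≤ c ^ k * (M / c ^ 2) * (1 / (1 + x ^ 2)) := by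
  obtain ⟨M, hM⟩ := exists_abs_eval_mul_exp_le
    ((1 + Polynomial.X ^ 2) * (Polynomial.hermite k).map (algebraMap ℤ ℝ))
  have hM0 : 0 ≤ M := le_trans (by positivity) (hM 0)
  refine ⟨M, hM0, fun c hc x y hx hxy => ?_⟩
  have h := hM (c * y)
  rw [Polynomial.eval_mul, Polynomial.eval_map_algebraMap, abs_mul, mul_assoc] at h
  have h1 : (Polynomial.eval (c * y) (1 + Polynomial.X ^ 2) : ℝ) = 1 + (c * y) ^ 2 := by simp
  rw [h1, abs_of_pos (by positivity)] at h
  rw [gaussianDeriv, abs_mul, abs_pow, abs_neg, abs_of_pos hc.1, abs_mul, Real.abs_exp, mul_assoc]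
  refine mul_le_mul_of_nonneg_left ?_ (pow_nonneg hc.1.le k)
  rw [← div_eq_mul_one_div, div_div, le_div_iff₀ (mul_pos (pow_pos hc.1 2) (by positivity)),
    mul_comm]
  refine (mul_le_mul_of_nonneg_right ?_ (by positivity)).trans h
  have : x ^ 2 ≤ y ^ 2 := pow_le_pow_left₀ hx hxy 2
  have : c ^ 2 ≤ 1 := pow_le_one₀ hc.1.le hc.2
  nlinarith [sq_nonneg c]

lemma summable_one_div_one_add_sq : Summable fun m : ℕ => 1 / (1 + (m : ℝ) ^ 2) := by
  refine Summable.of_norm_bounded_eventually_nat (Real.summable_one_div_nat_pow.2 one_lt_two) ?_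
  filter_upwards [eventually_gt_atTop 0] with m hm
  rw [Real.norm_of_nonneg (by positivity)]
  gcongr
  linarith

lemma summable_gaussianDeriv {c : ℝ} (hc : c ∈ Set.Ioc (0 : ℝ) 1) (k : ℕ) :
    Summable fun m : ℕ => gaussianDeriv c k m := by
  obtain ⟨M, -, hM⟩ := exists_abs_gaussianDeriv_le k
  exact Summable.of_norm_bounded (summable_one_div_one_add_sq.mul_left _)
    fun m => hM c hc m m m.cast_nonneg le_rfl

lemma sum_range_two_mul_of_odd_eq_zero {M : Type*} [AddCommMonoid M] {f : ℕ → M}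
    (hf : ∀ k, Odd k → f k = 0) (n : ℕ) :
    ∑ k ∈ Finset.range (2 * n), f k = ∑ l ∈ Finset.range n, f (2 * l) := by
  induction n with
  | zero => simp
  | succ n ih =>
    rw [mul_add, mul_one, Finset.sum_range_succ, Finset.sum_range_succ, ih, Finset.sum_range_succ,
      hf (2 * n + 1) ⟨n, rfl⟩, add_zero]

lemma Gamma_add_natCast {s : ℂ} (hs : 0 < s.re) (K : ℕ) :
    Gamma (s + K) = (∏ i ∈ Finset.range K, (s + i)) * Gamma s := by
  induction K with
  | zero => simp
  | succ K ih =>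
    have h : s + K ≠ 0 := fun h => by
      have := congrArg re h
      simp only [add_re, natCast_re, zero_re] at this
      linarith [K.cast_nonneg (α := ℝ)]
    rw [Nat.cast_succ, ← add_assoc, Gamma_add_one _ h, ih, Finset.prod_range_succ]
    ring

lemma prod_range_natCast_sub_eq (n : ℕ) :
    ∏ i ∈ Finset.range n, (-(n : ℂ) + i) = (-1) ^ n * n.factorial := by
  rw [← Finset.prod_range_reflect, ← Finset.prod_range_add_one_eq_factorial, Nat.cast_prod,
    ← Finset.card_range n, ← Finset.prod_const, Finset.card_range, ← Finset.prod_mul_distrib]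
  refine Finset.prod_congr rfl fun i hi => ?_
  have := Finset.mem_range.1 hi
  rw [Nat.sub_sub, Nat.cast_sub (by lia)]
  push_cast
  ring

/-- The function `F` with the polynomial `∑ j < K, a j * t ^ j` subtracted on `(0, 1]`. -/
noncomputable def subPolyNearZero (F : ℝ → ℂ) (a : ℕ → ℂ) (K : ℕ) (t : ℝ) : ℂ :=
  F t - ∑ j ∈ Finset.range K, a j * Set.indicator (Set.Ioc 0 1) (fun t : ℝ => (t : ℂ) ^ (j : ℂ)) t

lemma subPolyNearZero_succ (F : ℝ → ℂ) (a : ℕ → ℂ) (K : ℕ) :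
    subPolyNearZero F a (K + 1) = fun t => subPolyNearZero F a K t -
      a K • Set.indicator (Set.Ioc 0 1) (fun t : ℝ => (t : ℂ) ^ (K : ℂ)) t := by
  ext t
  simp [subPolyNearZero, Finset.sum_range_succ, sub_sub]

lemma hasMellin_subPolyNearZero {F : ℝ → ℂ} (a : ℕ → ℂ) {s m : ℂ} (hs : 0 < s.re)
    (hF : HasMellin F s m) (K : ℕ) :
    HasMellin (subPolyNearZero F a K) s (m - ∑ j ∈ Finset.range K, a j / (s + j)) := by
  induction K with
  | zero => simpa +unfoldPartialApp [subPolyNearZero] using hF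
  | succ K ih =>
    have hK := hasMellin_cpow_Ioc (K : ℂ) (s := s) (by
      rw [natCast_re]; exact add_pos_of_pos_of_nonneg hs K.cast_nonneg)
    have hK' := hasMellin_const_smul hK.1 (a K)
    have h := hasMellin_sub ih.1 hK'.1
    rw [ih.2, hK'.2, hK.2] at h
    rw [subPolyNearZero_succ, Finset.sum_range_succ, ← sub_sub]
    simpa [div_eq_mul_inv] using h

lemma locallyIntegrableOn_subPolyNearZero {F : ℝ → ℂ} (a : ℕ → ℂ)
    (hF : MeasureTheory.LocallyIntegrableOn F (Set.Ioi 0)) (K : ℕ) :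
    MeasureTheory.LocallyIntegrableOn (subPolyNearZero F a K) (Set.Ioi 0) := by
  induction K with
  | zero => simpa +unfoldPartialApp [subPolyNearZero] using hF
  | succ K ih =>
    have hK := (hasMellin_cpow_Ioc (K : ℂ) (s := 1) (by
      rw [natCast_re, one_re]; positivity)).1.const_smul (a K)
    rw [subPolyNearZero_succ]
    refine ih.sub (MeasureTheory.IntegrableOn.locallyIntegrableOn ?_)
    simpa [MellinConvergent] using hK

lemma differentiableAt_mellin_subPolyNearZero {F : ℝ → ℂ} {a : ℕ → ℂ} {K : ℕ}
    (hF : MeasureTheory.LocallyIntegrableOn F (Set.Ioi 0))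
    (htop : F =O[atTop] fun t : ℝ => Real.exp (-1 * t))
    (hbot : (fun t : ℝ => F t - ∑ j ∈ Finset.range K, a j * (t : ℂ) ^ j) =O[𝓝[>] 0]
      fun t : ℝ => t ^ K) {s : ℂ} (hs : -(K : ℝ) < s.re) :
    DifferentiableAt ℂ (mellin (subPolyNearZero F a K)) s := by
  refine mellin_differentiableAt_of_isBigO_rpow_exp one_pos
    (locallyIntegrableOn_subPolyNearZero a hF K) ?_ ?_ hs
  · refine htop.congr' ?_ EventuallyEq.rfl
    filter_upwards [eventually_gt_atTop 1] with t ht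
    simp [subPolyNearZero, ht]
  · refine hbot.congr' ?_ ?_
    · filter_upwards [Ioc_mem_nhdsGT one_pos] with t ht
      simp [subPolyNearZero, ht]
    · simp

/-- If the Mellin transform of a rapidly decaying function `F` is `Γ(s) D(s)` with `D` entire, the
coefficients of the asymptotic expansion of `F` at `0` are given by the values of `D` at
nonpositive integers. -/
lemma apply_neg_natCast_of_hasMellin_Gamma_mul {F : ℝ → ℂ} {D : ℂ → ℂ} {a : ℕ → ℂ} {l : ℕ} {σ : ℝ}
    (hσ : 0 ≤ σ) (hF : MeasureTheory.LocallyIntegrableOn F (Set.Ioi 0))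
    (htop : F =O[atTop] fun t : ℝ => Real.exp (-1 * t))
    (hbot : (fun t : ℝ => F t - ∑ j ∈ Finset.range (l + 1), a j * (t : ℂ) ^ j) =O[𝓝[>] 0]
      fun t : ℝ => t ^ (l + 1))
    (hD : Differentiable ℂ D) (hM : ∀ s : ℂ, σ < s.re → HasMellin F s (Gamma s * D s)) :
    D (-l) = a l * ((-1) ^ l * l.factorial) := by
  set K := l + 1 with hK
  set U : Set ℂ := {s | -(K : ℝ) < s.re} with hU
  have hUo : IsOpen U := isOpen_lt continuous_const continuous_re
  have hUc : IsPreconnected U := (convex_halfSpace_re_gt _).isPreconnected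
  set f : ℂ → ℂ := fun s => Gamma (s + K) * D s with hf
  set g : ℂ → ℂ := fun s => (∏ i ∈ Finset.range K, (s + i)) * mellin (subPolyNearZero F a K) s +
    ∑ j ∈ Finset.range K, a j * ∏ i ∈ (Finset.range K).erase j, (s + i) with hg
  have hfd : DifferentiableOn ℂ f U := by
    intro s hs
    refine DifferentiableAt.differentiableWithinAt (DifferentiableAt.mul ?_ (hD s))
    refine (differentiableAt_Gamma _ fun m hm => ?_).comp (f := fun s : ℂ => s + K) s (by fun_prop)
    have h1 := congrArg re hm
    have h2 : -(K : ℝ) < s.re := hs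
    simp only [add_re, natCast_re, neg_re] at h1
    linarith [m.cast_nonneg (α := ℝ)]
  have hgd : DifferentiableOn ℂ g U := by
    intro s hs
    have := differentiableAt_mellin_subPolyNearZero hF htop hbot hs
    exact DifferentiableAt.differentiableWithinAt (by fun_prop)
  have hone : ∀ᶠ s in 𝓝 ((σ : ℂ) + 1), f s = g s := by
    have : ∀ᶠ s : ℂ in 𝓝 ((σ : ℂ) + 1), σ < s.re :=
      (isOpen_lt continuous_const continuous_re).mem_nhds (by simp)
    filter_upwards [this] with s hs
    have hs0 : 0 < s.re := hσ.trans_lt hs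
    have hprod (j : ℕ) (hj : j ∈ Finset.range K) :
        a j * ∏ i ∈ (Finset.range K).erase j, (s + i) =
          (∏ i ∈ Finset.range K, (s + i)) * (a j / (s + j)) := by
      have h : s + j ≠ 0 := fun h => by
        have := congrArg re h
        simp only [add_re, natCast_re, zero_re] at this
        linarith [j.cast_nonneg (α := ℝ)]
      rw [← Finset.mul_prod_erase _ _ hj]
      field_simp
    simp only [hf, hg]
    rw [Finset.sum_congr rfl hprod, ← Finset.mul_sum,
      (hasMellin_subPolyNearZero a hs0 (hM s hs) K).2, Gamma_add_natCast hs0]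
    ring
  have hfg := (hfd.analyticOnNhd hUo).eqOn_of_preconnected_of_eventuallyEq
    (hgd.analyticOnNhd hUo) hUc (z₀ := (σ : ℂ) + 1)
    (by simp only [hU, Set.mem_ofPred_eq, add_re, ofReal_re, one_re]
        linarith [K.cast_nonneg (α := ℝ)]) hone
  have h := hfg (x := -(l : ℂ)) (by simp [hU, hK])
  simp only [hf, hg] at h
  have hz : ∏ i ∈ Finset.range K, (-(l : ℂ) + i) = 0 :=
    Finset.prod_eq_zero (i := l) (by simp [hK]) (by simp)
  rw [hz, zero_mul, zero_add, Finset.sum_eq_single_of_mem l (by simp [hK])] at h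
  · rw [← prod_range_natCast_sub_eq]
    simpa [hK, Finset.range_add_one] using h
  · intro j _ hj
    rw [Finset.prod_eq_zero (i := l) (by simp [hK, hj.symm]) (by simp), mul_zero]

/-- The Gaussian sum `∑_{n ≥ 1} C(n) exp(-n² t)` attached to a function on `ZMod N`. -/
noncomputable def gaussianSum {N : ℕ} (C : ZMod N → ℂ) (t : ℝ) : ℂ :=
  ∑' n : ℕ, C ((n + 1 : ℕ) : ZMod N) * (Real.exp (-((n : ℝ) + 1) ^ 2 * t) : ℂ)

section GaussianSum

variable {N : ℕ} [NeZero N]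

lemma norm_mul_exp_le (C : ZMod N → ℂ) {ε t : ℝ} (hε : 0 ≤ ε) (ht : ε ≤ t) (n : ℕ) :
    ‖C ((n + 1 : ℕ) : ZMod N) * (Real.exp (-((n : ℝ) + 1) ^ 2 * t) : ℂ)‖ ≤
      (∑ j, ‖C j‖) * Real.exp (-1 * t) * Real.exp (n * -ε) := by
  rw [norm_mul, norm_real, Real.norm_of_nonneg (Real.exp_nonneg _), mul_assoc, ← Real.exp_add]
  refine mul_le_mul
    (Finset.single_le_sum (f := fun j => ‖C j‖) (fun _ _ => norm_nonneg _) (Finset.mem_univ _))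
    (Real.exp_le_exp.2 ?_) (Real.exp_nonneg _) (by positivity)
  have h0 : (0 : ℝ) ≤ n := n.cast_nonneg
  nlinarith [mul_le_mul_of_nonneg_left ht h0, mul_nonneg h0 (hε.trans ht),
    mul_nonneg (mul_nonneg h0 h0) (hε.trans ht)]

lemma summable_mul_exp (C : ZMod N → ℂ) {t : ℝ} (ht : 0 < t) : Summable fun n : ℕ =>
    C ((n + 1 : ℕ) : ZMod N) * (Real.exp (-((n : ℝ) + 1) ^ 2 * t) : ℂ) :=
  Summable.of_norm_bounded
    ((Real.summable_exp_nat_mul_iff.2 (neg_lt_zero.2 ht)).mul_left _)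
    (norm_mul_exp_le C ht.le le_rfl)

lemma continuousOn_gaussianSum (C : ZMod N → ℂ) : ContinuousOn (gaussianSum C) (Set.Ioi 0) := by
  intro t ht
  have ht2 : 0 < t / 2 := half_pos ht
  have hcont : ContinuousOn (gaussianSum C) (Set.Ioi (t / 2)) := by
    refine continuousOn_tsum (fun n => by fun_prop)
      ((Real.summable_exp_nat_mul_iff.2 (neg_lt_zero.2 ht2)).mul_left (∑ j, ‖C j‖))
      fun n u hu => (norm_mul_exp_le C ht2.le (le_of_lt hu) n).trans ?_
    gcongr
    refine mul_le_of_le_one_right (by positivity) (Real.exp_le_one_iff.2 ?_)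
    linarith [Set.mem_Ioi.1 hu]
  exact (hcont.continuousAt (Ioi_mem_nhds (half_lt_self ht))).continuousWithinAt

lemma isBigO_gaussianSum_atTop (C : ZMod N → ℂ) :
    gaussianSum C =O[atTop] fun t : ℝ => Real.exp (-1 * t) := by
  refine Asymptotics.IsBigO.of_bound ((∑ j, ‖C j‖) * ∑' n : ℕ, Real.exp (n * -1)) ?_
  filter_upwards [eventually_ge_atTop 1] with t ht
  have h := tsum_of_norm_bounded
    ((Real.summable_exp_nat_mul_iff.2 (neg_lt_zero.2 one_pos)).mul_left _).hasSum
    (norm_mul_exp_le C zero_le_one ht)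
  rw [tsum_mul_left] at h
  rw [Real.norm_of_nonneg (Real.exp_nonneg _)]
  exact h.trans_eq (by ring)

lemma hasSum_LFunction (C : ZMod N → ℂ) {s : ℂ} (hs : 1 < s.re) :
    HasSum (fun n : ℕ => C ((n + 1 : ℕ) : ZMod N) / ((n + 1 : ℕ) : ℂ) ^ s)
      (ZMod.LFunction C s) := by
  have h := (ZMod.LSeriesSummable_of_one_lt_re C hs).hasSum
  rw [← LSeries, ← ZMod.LFunction_eq_LSeries C hs] at h
  simpa [LSeries.term] using (hasSum_nat_add_iff' 1).2 h

lemma mellin_gaussianSum (C : ZMod N → ℂ) {s : ℂ} (hs : 1 / 2 < s.re) :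
    mellin (gaussianSum C) s = Gamma s * ZMod.LFunction C (2 * s) := by
  have hs2 : 1 < (2 * s).re := by simp; linarith
  have hL := hasSum_LFunction C hs2
  have h := hasSum_mellin (a := fun n : ℕ => C ((n + 1 : ℕ) : ZMod N))
    (p := fun n : ℕ => ((n : ℝ) + 1) ^ 2) (F := gaussianSum C) (s := s)
    (fun n => Or.inr (by positivity)) (by linarith)
    (fun t ht => by
      convert! (summable_mul_exp C ht).hasSum)
    (by
      refine hL.summable.norm.congr fun n => ?_
      rw [norm_div, norm_natCast_cpow_of_pos n.succ_pos, ← Real.rpow_natCast,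
        ← Real.rpow_mul (by positivity)]
      simp)
  refine h.unique ((hL.mul_left (Gamma s)).congr_fun fun n => ?_)
  have hn : (((((n : ℝ) + 1) ^ 2 : ℝ) : ℂ)) ^ s = ((n + 1 : ℕ) : ℂ) ^ (2 * s) := by
    rw [pow_two, ofReal_mul, mul_cpow_ofReal_nonneg (by positivity) (by positivity), two_mul,
      cpow_add _ _ (by exact_mod_cast n.succ_ne_zero)]
    simp
  rw [hn, mul_div_assoc]

lemma gaussianSum_eq_tsum_sum (C : ZMod N → ℂ) {t : ℝ} (ht : 0 < t) :
    gaussianSum C t = ∑' m : ℕ, ∑ j : ZMod N,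
      C (j + 1) * (gaussianDeriv (N * √(2 * t)) 0 (m + (j.val + 1) / N) : ℂ) := by
  have hN : (N : ℝ) ≠ 0 := Nat.cast_ne_zero.2 (NeZero.ne N)
  have hterm (j : ZMod N) (m : ℕ) : C ((j.val + N * m + 1 : ℕ) : ZMod N) *
      (Real.exp (-(((j.val + N * m : ℕ) : ℝ) + 1) ^ 2 * t) : ℂ) =
      C (j + 1) * (gaussianDeriv (N * √(2 * t)) 0 (m + (j.val + 1) / N) : ℂ) := by
    have h : N * √(2 * t) * ((m : ℝ) + (j.val + 1) / N) =
        √(2 * t) * (j.val + N * m + 1) := by field_simp; ring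
    rw [gaussianDeriv_zero, h, mul_pow, Real.sq_sqrt (by positivity)]
    congr 3
    · simp
    · push_cast; ring
  have hs := summable_mul_exp C ht
  rw [gaussianSum, Nat.sumByResidueClasses hs N, Summable.tsum_finsetSum]
  · simp_rw [hterm]
  · intro j _
    simp_rw [← hterm]
    exact hs.comp_injective (i := fun m : ℕ => j.val + N * m) fun m m' h => by
      simpa [NeZero.ne N] using h

lemma exists_gaussianSum_expansion {C : ZMod N → ℂ} (hC : ∑ x, C x = 0) :
    ∃ a : ℕ → ℂ, ∀ K : ℕ,
      (fun t : ℝ => gaussianSum C t - ∑ l ∈ Finset.range K, a l * (t : ℂ) ^ l) =O[𝓝[>] 0]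
        fun t : ℝ => t ^ K := by
  have hN : (0 : ℝ) < N := Nat.cast_pos.2 (NeZero.pos N)
  set x : ZMod N → ℝ := fun j => (j.val + 1) / N with hx
  have hx01 (j : ZMod N) : x j ∈ Set.Icc (0 : ℝ) 1 :=
    ⟨by positivity, (div_le_one hN).2 (by exact_mod_cast ZMod.val_lt j)⟩
  have hw : ∑ j : ZMod N, C (j + 1) = 0 := by
    rw [← hC]; exact Equiv.sum_comp (Equiv.addRight (1 : ZMod N)) C
  set β : ℕ → ℂ := fun k =>
    ∑ j, C (j + 1) * (bernoulliFun (k + 1) (x j) / (k + 1).factorial : ℝ) with hβ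
  set a : ℕ → ℂ := fun l =>
    -(β (2 * l) * ((2 * (N : ℂ) ^ 2) ^ l * ((Polynomial.hermite (2 * l)).coeff 0 : ℂ))) with ha
  refine ⟨a, fun K => ?_⟩
  obtain ⟨M, hM0, hM⟩ := exists_abs_gaussianDeriv_le (2 * K + 1 + 1)
  have hbound : ∀ᶠ t : ℝ in 𝓝[>] 0, ‖gaussianSum C t -
      ∑ l ∈ Finset.range (K + 1), a l * (t : ℂ) ^ l‖ ≤
      ((∑ j, ‖C (j + 1)‖) * ((2 * N ^ 2) ^ K * M * ∑' m : ℕ, 1 / (1 + (m : ℝ) ^ 2))) *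
        ‖t ^ K‖ := by
    filter_upwards [Ioc_mem_nhdsGT (show (0 : ℝ) < 1 / (2 * N ^ 2) by positivity)] with t ht
    have ht0 : 0 < t := ht.1
    set c : ℝ := N * √(2 * t) with hc
    have hc2 : c ^ 2 = 2 * N ^ 2 * t := by
      rw [hc, mul_pow, Real.sq_sqrt (by positivity)]; ring
    have hc0 : 0 < c := by positivity
    have hc1 : c ∈ Set.Ioc (0 : ℝ) 1 := by
      refine ⟨hc0, (sq_le_one_iff₀ hc0.le).1 ?_⟩
      rw [hc2, mul_comm]
      exact (le_div_iff₀ (by positivity)).1 ht.2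
    have h := norm_tsum_add_eulerMaclaurin_le hw hx01 (hasDerivAt_gaussianDeriv c)
      (summable_gaussianDeriv hc1) (K := 2 * K + 1)
      (summable_one_div_one_add_sq.mul_left (c ^ (2 * K + 1 + 1) * (M / c ^ 2)))
      (fun m y hy => hM c hc1 m (m + y) m.cast_nonneg (le_add_of_nonneg_right hy.1))
    rw [← gaussianSum_eq_tsum_sum C ht0] at h
    have hsum : ∑ k ∈ Finset.range (2 * K + 1), β k * (gaussianDeriv c k 0 : ℂ) =
        -∑ l ∈ Finset.range (K + 1), a l * (t : ℂ) ^ l := by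
      have heven (l : ℕ) : β (2 * l) * (gaussianDeriv c (2 * l) 0 : ℂ) = -(a l * (t : ℂ) ^ l) := by
        rw [gaussianDeriv_apply_zero, pow_mul, neg_sq, hc2, mul_pow]
        simp only [ha]
        push_cast
        ring
      rw [Finset.sum_range_succ, sum_range_two_mul_of_odd_eq_zero
        (fun k hk => by rw [gaussianDeriv_apply_zero_of_odd c hk, ofReal_zero, mul_zero]),
        ← Finset.sum_range_succ (fun l => β (2 * l) * (gaussianDeriv c (2 * l) 0 : ℂ))]
      simp only [heven, Finset.sum_neg_distrib]
    rw [hsum, ← sub_eq_add_neg, tsum_mul_left] at h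
    refine h.trans_eq ?_
    have : c ^ (2 * K + 1 + 1) * (M / c ^ 2) = (2 * N ^ 2) ^ K * t ^ K * M := by
      rw [← mul_pow, ← hc2]
      field_simp
      ring
    rw [this, Real.norm_of_nonneg (by positivity)]
    ring
  refine ((Asymptotics.IsBigO.of_bound _ hbound).add (g := fun t : ℝ => t ^ K)
    (f₂ := fun t : ℝ => a K * (t : ℂ) ^ K) ?_).congr_left fun t => ?_
  · exact Asymptotics.IsBigO.of_bound ‖a K‖ (Eventually.of_forall fun t => by simp)
  · rw [Finset.sum_range_succ]; ring

end GaussianSum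

/-- Gaussian Lawrence–Zagier asymptotic expansion. If `Σ_x C x = 0`
then `Σ_{n≥1} C(n) e^{−n²t}` has the asymptotic expansion
`Σ_ℓ L(−2ℓ, C)·(−t)^ℓ/ℓ!` as `t → 0⁺`. -/
theorem lawrenceZagier_asymptotic_gaussian (N : ℕ) [NeZero N]
    (C : ZMod N → ℂ) (hC : ∑ x : ZMod N, C x = 0) (K : ℕ) :
    Asymptotics.IsBigO (𝓝[>] (0 : ℝ))
      (fun t : ℝ =>
        (∑' n : ℕ, C ((n + 1 : ℕ) : ZMod N) *
            (Real.exp (-((n : ℝ) + 1) ^ 2 * t) : ℂ)) -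
          ∑ ℓ ∈ Finset.range K,
            ZMod.LFunction C (-(2 * ℓ : ℂ)) * (-(t : ℂ)) ^ ℓ / (ℓ.factorial : ℂ))
      (fun t : ℝ => t ^ K) := by
  obtain ⟨a, ha⟩ := exists_gaussianSum_expansion hC
  have hloc : MeasureTheory.LocallyIntegrableOn (gaussianSum C) (Set.Ioi 0) :=
    (continuousOn_gaussianSum C).locallyIntegrableOn measurableSet_Ioi
  have htop := isBigO_gaussianSum_atTop C
  have hcoeff (l : ℕ) : ZMod.LFunction C (-(2 * l : ℂ)) = a l * ((-1) ^ l * l.factorial) := by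
    have hD : Differentiable ℂ fun s : ℂ => ZMod.LFunction C (2 * s) :=
      (ZMod.differentiable_LFunction_of_sum_zero hC).comp (differentiable_id.const_mul 2)
    rw [← apply_neg_natCast_of_hasMellin_Gamma_mul (σ := 1 / 2) (by positivity) hloc htop
      (ha (l + 1)) hD fun s hs => ⟨?_, mellin_gaussianSum C hs⟩, mul_neg]
    exact mellinConvergent_of_isBigO_rpow_exp one_pos hloc htop (b := 0)
      (by simpa using ha 0) (by linarith)
  refine (ha K).congr_left fun t => ?_
  rw [gaussianSum]
  congr 1
  refine Finset.sum_congr rfl fun l _ => ?_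
  have hl : (l.factorial : ℂ) ≠ 0 := Nat.cast_ne_zero.2 l.factorial_ne_zero
  rw [hcoeff, neg_pow (t : ℂ), eq_div_iff hl]
  have h1 : ((-1 : ℂ) ^ l) * (-1) ^ l = 1 := by rw [← mul_pow]; simp
  linear_combination (-(a l * l.factorial * (t : ℂ) ^ l)) * h1
end

section
/- Let m and r be integers with 0 < r < m, and let C_{m,r} : ZMod (2m) → ℂ be the function with C_{m,r}(x) = 1 if x = r, C_{m,r}(x) = −1 if x = −r, and C_{m,r}(x) = 0 otherwise. Then for every complex number z with |z| < π/m one has sinh((m − r) z)/sinh(m z) = Σ_{ℓ=0}^∞ L(−2ℓ, C_{m,r}) · z^{2ℓ}/(2ℓ)! (the left-hand side extends holomorphically across z = 0 and the series converges absolutely on |z| < π/m). -/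
open Complex

/-- The `2m`-periodic function which is `+1` on `r`, `−1` on `−r`, `0` elsewhere. -/
def Cmr (m r : ℕ) : ZMod (2 * m) → ℂ :=
  fun x => if x = (r : ZMod (2 * m)) then 1
    else if x = -(r : ZMod (2 * m)) then -1 else 0

section

open Filter Topology Set

lemma hasDerivAt_ofReal_cpow_of_pos {y : ℝ} (hy : 0 < y) (c : ℂ) :
    HasDerivAt (fun u : ℝ ↦ (u : ℂ) ^ c) (c * (y : ℂ) ^ (c - 1)) y := by
  simpa using ((hasDerivAt_id (y : ℂ)).cpow_const (c := c)
    (by simpa using hy)).comp_ofReal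

lemma norm_cpow_sub_cpow_le {a y : ℝ} (ha : 0 < a) (hay : a ≤ y) {c : ℂ} (hc : c.re ≤ 1) :
    ‖(y : ℂ) ^ c - (a : ℂ) ^ c‖ ≤ ‖c‖ * a ^ (c.re - 1) * (y - a) := by
  have h := (convex_Icc a y).norm_image_sub_le_of_norm_hasDerivWithin_le
    (f := fun u : ℝ ↦ (u : ℂ) ^ c) (f' := fun u : ℝ ↦ c * (u : ℂ) ^ (c - 1))
    (C := ‖c‖ * a ^ (c.re - 1))
    (fun u hu ↦ (hasDerivAt_ofReal_cpow_of_pos (ha.trans_le hu.1) c).hasDerivWithinAt)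
    (fun u hu ↦ by
      rw [norm_mul, norm_cpow_eq_rpow_re_of_pos (ha.trans_le hu.1), sub_re, one_re]
      gcongr ?_ * ?_
      exact Real.rpow_le_rpow_of_nonpos ha hu.1 (by linarith))
    (left_mem_Icc.mpr hay) (right_mem_Icc.mpr hay)
  rwa [Real.norm_of_nonneg (sub_nonneg.mpr hay)] at h

lemma norm_cpow_sub_linear_le {a y : ℝ} (ha : 0 < a) (hay : a ≤ y) {c : ℂ} (hc : c.re ≤ 1) :
    ‖(y : ℂ) ^ c - (a : ℂ) ^ c - c * (y - a) * (a : ℂ) ^ (c - 1)‖ ≤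
      ‖c‖ * ‖c - 1‖ * a ^ (c.re - 2) * (y - a) ^ 2 := by
  have h := (convex_Icc a y).norm_image_sub_le_of_norm_hasDerivWithin_le
    (f := fun u : ℝ ↦ (u : ℂ) ^ c - u * (c * (a : ℂ) ^ (c - 1)))
    (f' := fun u : ℝ ↦ c * (u : ℂ) ^ (c - 1) - 1 * (c * (a : ℂ) ^ (c - 1)))
    (C := ‖c‖ * (‖c - 1‖ * a ^ (c.re - 2) * (y - a)))
    (fun u hu ↦ ((hasDerivAt_ofReal_cpow_of_pos (ha.trans_le hu.1) c).sub
      ((hasDerivAt_id (u : ℂ)).comp_ofReal.mul_const _)).hasDerivWithinAt)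
    (fun u hu ↦ by
      rw [one_mul, ← mul_sub, norm_mul]
      have hb := norm_cpow_sub_cpow_le ha hu.1 (c := c - 1) (by simp; linarith)
      rw [sub_re, one_re, sub_sub, one_add_one_eq_two] at hb
      gcongr
      refine hb.trans ?_
      gcongr
      exact hu.2)
    (left_mem_Icc.mpr hay) (right_mem_Icc.mpr hay)
  rw [Real.norm_of_nonneg (sub_nonneg.mpr hay)] at h
  convert h using 1
  · congr 1; ring
  · ring

lemma differentiable_update_mul_riemannZeta_add_one :
    Differentiable ℂ (Function.update (fun s ↦ s * riemannZeta (s + 1)) 0 1) := by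
  rw [← differentiableOn_univ,
    ← differentiableOn_compl_singleton_and_continuousAt_iff (c := (0 : ℂ)) univ_mem]
  constructor
  · have h : DifferentiableOn ℂ (fun s : ℂ ↦ s * riemannZeta (s + 1)) (univ \ {0}) := fun s hs ↦
      (differentiableAt_id.mul ((differentiableAt_riemannZeta (by simpa using hs.2)).comp s
        (differentiableAt_id.add_const 1))).differentiableWithinAt
    exact h.congr fun s hs ↦ Function.update_of_ne hs.2 _ _
  · rw [continuousAt_update_same]
    have h : Tendsto (fun s : ℂ ↦ s + 1) (𝓝[≠] 0) (𝓝[≠] 1) := by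
      refine tendsto_nhdsWithin_iff.mpr ⟨?_, ?_⟩
      · exact ((continuous_add_const (1 : ℂ)).tendsto' 0 1 (by simp)).mono_left nhdsWithin_le_nhds
      · filter_upwards [self_mem_nhdsWithin] with s hs using by simpa using hs
    simpa [Function.comp_def] using riemannZeta_residue_one.comp h

lemma hurwitzZeta_apply_zero {x : ℝ} (hx : x ∈ Ioo 0 1) :
    HurwitzZeta.hurwitzZeta x 0 = 1 / 2 - x := by
  set U : Set ℂ := Metric.ball 0 4 ∩ {s | -1 / 2 < s.re}
  have hUo : IsOpen U := Metric.isOpen_ball.inter (isOpen_lt continuous_const continuous_re)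
  have hUc : IsPreconnected U :=
    ((convex_ball _ _).inter (convex_halfSpace_re_gt _)).isPreconnected
  let t (n : ℕ) (s : ℂ) : ℂ := ((n + 1 + x : ℝ) : ℂ) ^ (-s) - ((n + 1 : ℝ) : ℂ) ^ (-s) -
    (-s) * x * ((n + 1 : ℝ) : ℂ) ^ (-s - 1)
  have hpos (n : ℕ) : (0 : ℝ) < n + 1 := by positivity
  have hpos' (n : ℕ) : (0 : ℝ) < n + 1 + x := add_pos (hpos n) hx.1
  have hG : DifferentiableOn ℂ (fun s ↦ ∑' n, t n s) U := by
    refine differentiableOn_tsum_of_summable_norm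
      (u := fun n : ℕ ↦ 20 * (1 / |(n : ℝ) + 1| ^ (3 / 2 : ℝ)))
      (((Real.summable_one_div_nat_add_rpow 1 _).mpr (by norm_num)).mul_left 20)
      (fun n ↦ ?_) hUo fun n s hs ↦ ?_
    · have h1 : ((n + 1 : ℝ) : ℂ) ≠ 0 := ofReal_ne_zero.mpr (hpos n).ne'
      have h2 : ((n + 1 + x : ℝ) : ℂ) ≠ 0 := ofReal_ne_zero.mpr (hpos' n).ne'
      refine Differentiable.differentiableOn ?_
      refine ((differentiable_neg.const_cpow (.inl h2)).sub
        (differentiable_neg.const_cpow (.inl h1))).sub ((differentiable_neg.mul_const _).mul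
          ((differentiable_neg.sub_const 1).const_cpow (.inl h1)))
    · have hs1 : ‖s‖ < 4 := by simpa using hs.1
      have hs2 : -1 / 2 < s.re := hs.2
      have h := norm_cpow_sub_linear_le (hpos n) (y := n + 1 + x) (by linarith [hx.1]) (c := -s)
        (by simp; linarith)
      have hs3 : ‖-s - 1‖ ≤ 5 := by
        rw [← neg_add', norm_neg]
        exact (norm_add_le _ _).trans (by rw [norm_one]; linarith)
      have hxx : ((n + 1 + x : ℝ) : ℂ) - ((n + 1 : ℝ) : ℂ) = x := by push_cast; ring
      rw [hxx, add_sub_cancel_left] at h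
      refine h.trans ?_
      rw [abs_of_pos (hpos n), one_div, ← Real.rpow_neg (hpos n).le, norm_neg]
      have h3 : ((n : ℝ) + 1) ^ ((-s).re - 2) ≤ ((n : ℝ) + 1) ^ (-(3 / 2 : ℝ)) :=
        Real.rpow_le_rpow_of_exponent_le (by linarith [(n.cast_nonneg : (0 : ℝ) ≤ n)])
          (by simp; linarith)
      have h4 : x ^ 2 ≤ 1 := pow_le_one₀ hx.1.le hx.2.le
      calc ‖s‖ * ‖-s - 1‖ * ((n : ℝ) + 1) ^ ((-s).re - 2) * x ^ 2
          ≤ 4 * 5 * ((n : ℝ) + 1) ^ (-(3 / 2 : ℝ)) * 1 := by gcongr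
        _ = _ := by ring
  let F (s : ℂ) : ℂ := (HurwitzZeta.hurwitzZeta x s - HurwitzZeta.hurwitzZeta 0 s) -
    (x : ℂ) ^ (-s) + x * Function.update (fun s ↦ s * riemannZeta (s + 1)) 0 1 s
  have hF : Differentiable ℂ F := by
    refine ((HurwitzZeta.differentiable_hurwitzZeta_sub_hurwitzZeta _ _).sub
      (differentiable_neg.const_cpow (.inl (ofReal_ne_zero.mpr hx.1.ne')))).add
      (differentiable_update_mul_riemannZeta_add_one.const_mul _)
  have h2 : (2 : ℂ) ∈ U := by constructor <;> simp <;> norm_num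
  have h0 : (0 : ℂ) ∈ U := by constructor <;> simp; norm_num
  have hFG : F =ᶠ[𝓝 2] fun s ↦ ∑' n, t n s := by
    have hV : {s : ℂ | 1 < s.re} ∈ 𝓝 2 :=
      (isOpen_lt continuous_const continuous_re).mem_nhds (by simp)
    filter_upwards [hV] with s hs
    have hs : 1 < s.re := hs
    have hs0 : s ≠ 0 := ne_zero_of_one_lt_re hs
    have e1 := (hasSum_nat_add_iff' 1).mpr
      (HurwitzZeta.hasSum_hurwitzZeta_of_one_lt_re (Ioo_subset_Icc_self hx) hs)
    have hz {s : ℂ} (hs : 1 < s.re) :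
        HasSum (fun n : ℕ ↦ 1 / (n + 1 : ℂ) ^ s) (riemannZeta s) := by
      rw [zeta_eq_tsum_one_div_nat_add_one_cpow hs]
      refine Summable.hasSum ?_
      simpa using (summable_nat_add_iff 1).mpr (Complex.summable_one_div_nat_cpow.mpr hs)
    have e2 := (e1.sub (hz hs)).add ((hz (s := s + 1) (by simp; linarith)).mul_left (s * x))
    have e3 : HasSum (fun n ↦ t n s) (F s) := by
      have hFs : F s = HurwitzZeta.hurwitzZeta x s -
          ∑ i ∈ Finset.range 1, 1 / ((i : ℂ) + x) ^ s - riemannZeta s +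
          s * x * riemannZeta (s + 1) := by
        simp only [F, HurwitzZeta.hurwitzZeta_zero, Function.update_of_ne hs0]
        simp [cpow_neg]
        ring
      rw [hFs]
      refine e2.congr_fun fun n ↦ ?_
      simp only [t]
      push_cast
      rw [← neg_add', cpow_neg, cpow_neg, cpow_neg]
      ring
    exact e3.tsum_eq.symm
  have key := (hF.differentiableOn.analyticOnNhd hUo).eqOn_of_preconnected_of_eventuallyEq
    (hG.analyticOnNhd hUo) hUc h2 hFG h0
  have ht (n : ℕ) : t n 0 = 0 := by simp [t]
  simp only [ht, tsum_zero, F, HurwitzZeta.hurwitzZeta_zero, riemannZeta_zero,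
    Function.update_self, neg_zero, cpow_zero] at key
  linear_combination key

lemma hurwitzZeta_neg_natCast {x : ℝ} (hx : x ∈ Ioo 0 1) (k : ℕ) :
    HurwitzZeta.hurwitzZeta x (-k) =
      -1 / (k + 1) * ((Polynomial.bernoulli (k + 1)).map (algebraMap ℚ ℂ)).eval (x : ℂ) := by
  rcases eq_or_ne k 0 with rfl | hk
  · simp [hurwitzZeta_apply_zero hx]
  · exact HurwitzZeta.hurwitzZeta_neg_nat hk (Ioo_subset_Icc_self hx)

/-- The coefficient of `w ^ n` in `w * exp (x * w) / (exp w - 1)`. -/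
noncomputable def bernoulliCoeff (x : ℝ) (n : ℕ) : ℂ :=
  ((Polynomial.bernoulli n).map (algebraMap ℚ ℂ)).eval (x : ℂ) / n.factorial

lemma bernoulliCoeff_eq_bernoulliFun (x : ℝ) (n : ℕ) :
    bernoulliCoeff x n = (bernoulliFun n x : ℂ) / n.factorial := by
  have h : (Polynomial.bernoulli n).map (algebraMap ℚ ℂ) = _ :=
    (Polynomial.map_map (algebraMap ℚ ℝ) ofRealHom _).symm
  rw [bernoulliCoeff, bernoulliFun, h, ← ofRealHom_eq_coe, ← ofRealHom_eq_coe,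
    Polynomial.eval_map_apply]

lemma bernoulliCoeff_one_sub (x : ℝ) (n : ℕ) :
    bernoulliCoeff (1 - x) n = (-1) ^ n * bernoulliCoeff x n := by
  simp only [bernoulliCoeff_eq_bernoulliFun, bernoulliFun_eval_one_sub]
  push_cast
  ring

lemma norm_bernoulliCoeff_mul_le {x : ℝ} (hx : x ∈ Icc 0 1) {n : ℕ} (hn : 2 ≤ n) :
    ‖bernoulliCoeff x n‖ * (2 * Real.pi) ^ n ≤ ∑' k : ℕ, 2 / (k : ℝ) ^ 2 := by
  have hsum : Summable fun k : ℕ ↦ 2 / (k : ℝ) ^ 2 := by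
    simpa [div_eq_mul_inv] using (Real.summable_nat_pow_inv.mpr one_lt_two).mul_left 2
  have h := hasSum_one_div_nat_pow_mul_fourier hn hx
  have hb := tsum_of_norm_bounded hsum.hasSum (f := fun k : ℕ ↦
      (1 : ℂ) / (k : ℂ) ^ n * (fourier k (x : UnitAddCircle) +
        (-1 : ℂ) ^ n * fourier (-k) (x : UnitAddCircle))) fun k ↦ by
    rw [norm_mul, mul_comm, div_eq_mul_inv (2 : ℝ)]
    gcongr
    · refine (norm_add_le _ _).trans ?_
      rw [norm_mul, norm_pow, norm_neg, norm_one, one_pow, one_mul, fourier_apply, fourier_apply,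
        Circle.norm_coe, Circle.norm_coe, one_add_one_eq_two]
    · rcases k.eq_zero_or_pos with rfl | hk
      · simp [show n ≠ 0 by lia]
      · have hk' : (1 : ℝ) ≤ k := by exact_mod_cast hk
        simp only [one_div, norm_inv, norm_pow, Complex.norm_natCast]
        gcongr
  rw [h.tsum_eq] at hb
  convert hb using 1
  rw [bernoulliCoeff_eq_bernoulliFun]
  simp [abs_of_pos Real.pi_pos]
  ring

lemma summable_norm_bernoulliCoeff_add {x : ℝ} (hx : x ∈ Icc 0 1) {w : ℂ}
    (hw : ‖w‖ < 2 * Real.pi) (j : ℕ) :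
    Summable fun n ↦ ‖bernoulliCoeff x (n + j) * w ^ n‖ := by
  have hpi : 0 < 2 * Real.pi := by positivity
  rw [← summable_nat_add_iff 2]
  set K := ∑' k : ℕ, 2 / (k : ℝ) ^ 2
  refine Summable.of_nonneg_of_le (fun _ ↦ norm_nonneg _) (fun n ↦ ?_)
    (((summable_nat_add_iff 2).mpr (summable_geometric_of_lt_one (by positivity)
      ((div_lt_one hpi).mpr hw))).mul_left (K / (2 * Real.pi) ^ j))
  have h := norm_bernoulliCoeff_mul_le hx (show 2 ≤ n + 2 + j by lia)
  rw [← le_div_iff₀ (by positivity)] at h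
  rw [norm_mul, norm_pow, div_pow]
  calc _ ≤ K / (2 * Real.pi) ^ (n + 2 + j) * ‖w‖ ^ (n + 2) := by gcongr
    _ = _ := by rw [pow_add _ (n + 2) j]; field_simp

lemma hasSum_bernoulliCoeff_mul_pow {x : ℝ} (hx : x ∈ Icc 0 1) {w : ℂ}
    (hw : ‖w‖ < 2 * Real.pi) (hw0 : exp w ≠ 1) :
    HasSum (fun n ↦ bernoulliCoeff x n * w ^ n) (w * exp (x * w) / (exp w - 1)) := by
  have hb : Summable fun n ↦ ‖bernoulliCoeff x n * w ^ n‖ :=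
    summable_norm_bernoulliCoeff_add hx hw 0
  have hexp (u : ℂ) : HasSum (fun n : ℕ ↦ u ^ n / n.factorial) (exp u) := by
    rw [exp_eq_exp_ℂ]
    exact NormedSpace.exp_series_hasSum_exp' u |>.congr_fun fun n ↦ by
      rw [smul_eq_mul]; ring
  let e (n : ℕ) : ℂ := PowerSeries.coeff n (PowerSeries.exp ℂ - 1) * w ^ n
  have he : HasSum e (exp w - 1) := by
    refine ((hexp w).sub (hasSum_ite_eq 0 (1 : ℂ))).congr_fun fun n ↦ ?_
    rcases eq_or_ne n 0 with rfl | hn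
    · simp [e]
    · simp [e, hn, PowerSeries.coeff_one, PowerSeries.coeff_exp]
      ring
  have hprod : HasSum (fun n ↦ ∑ kl ∈ Finset.HasAntidiagonal.antidiagonal n,
      bernoulliCoeff x kl.1 * w ^ kl.1 * e kl.2) (w * exp (x * w)) := by
    rw [← hasSum_nat_add_iff' 1]
    have hgen := PowerSeries.ext_iff.mp (Polynomial.bernoulli_generating_function (x : ℂ))
    have hn (n : ℕ) : ∑ kl ∈ Finset.HasAntidiagonal.antidiagonal n,
        bernoulliCoeff x kl.1 * w ^ kl.1 * e kl.2 = PowerSeries.coeff n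
          (PowerSeries.X * PowerSeries.rescale (x : ℂ) (PowerSeries.exp ℂ)) * w ^ n := by
      rw [← hgen, PowerSeries.coeff_mul, Finset.sum_mul]
      refine Finset.sum_congr rfl fun kl hkl ↦ ?_
      rw [← Finset.HasAntidiagonal.mem_antidiagonal.mp hkl, PowerSeries.coeff_mk, pow_add,
        bernoulliCoeff, map_smul, Polynomial.aeval_def, Polynomial.eval_map, Algebra.smul_def]
      simp [e]
      ring
    simp only [hn, Finset.range_one, Finset.sum_singleton, PowerSeries.coeff_succ_X_mul,
      PowerSeries.coeff_zero_X_mul, zero_mul, sub_zero]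
    refine ((hexp (x * w)).mul_left w).congr_fun fun n ↦ ?_
    simp [PowerSeries.coeff_rescale, PowerSeries.coeff_exp, mul_pow]
    ring
  have h := tsum_mul_tsum_eq_tsum_sum_antidiagonal_of_summable_norm hb he.summable.norm
  rw [hprod.tsum_eq, he.tsum_eq] at h
  rw [← h, mul_div_cancel_right₀ _ (sub_ne_zero.mpr hw0)]
  exact hb.of_norm.hasSum

lemma hasSum_bernoulliCoeff_odd {x : ℝ} (hx : x ∈ Icc 0 1) {w : ℂ}
    (hw : ‖w‖ < 2 * Real.pi) (hw0 : exp w ≠ 1) :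
    HasSum (fun n ↦ 2 * bernoulliCoeff x (2 * n + 1) * w ^ (2 * n + 1))
      (w * (exp (x * w) - exp ((1 - x) * w)) / (exp w - 1)) := by
  have hx' : 1 - x ∈ Icc (0 : ℝ) 1 := ⟨by linarith [hx.2], by linarith [hx.1]⟩
  have h := (hasSum_bernoulliCoeff_mul_pow hx hw hw0).sub
    (hasSum_bernoulliCoeff_mul_pow hx' hw hw0)
  have hinj : Function.Injective fun n : ℕ ↦ 2 * n + 1 := fun a b hab ↦ by
    simpa using hab
  rw [← hinj.hasSum_iff fun n hn ↦ ?_] at h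
  · rw [mul_sub, sub_div]
    rw [ofReal_sub, ofReal_one] at h
    refine h.congr_fun fun n ↦ ?_
    rw [Function.comp_apply, bernoulliCoeff_one_sub, (odd_two_mul_add_one n).neg_one_pow]
    ring
  · have hn : Even n := by
      rw [← Nat.not_odd_iff_even]
      exact fun ⟨k, hk⟩ ↦ hn ⟨k, hk.symm⟩
    rw [bernoulliCoeff_one_sub, hn.neg_one_pow]
    ring

lemma LFunction_Cmr_neg_two_mul {m r : ℕ} [NeZero (2 * m)] (hr : 0 < r) (hrm : r < m) (l : ℕ) :
    ZMod.LFunction (Cmr m r) (-(2 * l : ℂ)) =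
      -(2 * m : ℂ) ^ (2 * l) * (2 * l).factorial *
        (2 * bernoulliCoeff (r / (2 * m : ℝ)) (2 * l + 1)) := by
  have hm : (0 : ℝ) < 2 * m := by
    have : (0 : ℝ) < m := by exact_mod_cast hr.trans hrm
    positivity
  have hrm' : (r : ℝ) < m := by exact_mod_cast hrm
  have hr' : (0 : ℝ) < r := by exact_mod_cast hr
  set x : ℝ := r / (2 * m) with hxdef
  have hx : x ∈ Ioo 0 1 := ⟨by positivity, (div_lt_one hm).mpr (by linarith)⟩
  have hx' : 1 - x ∈ Ioo (0 : ℝ) 1 := ⟨by linarith [hx.2], by linarith [hx.1]⟩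
  have hne : (r : ZMod (2 * m)) ≠ -r := by
    rw [Ne, eq_neg_iff_add_eq_zero, ← Nat.cast_add, ZMod.natCast_eq_zero_iff]
    exact fun h ↦ absurd (Nat.le_of_dvd (by lia) h) (by lia)
  have hC (j : ZMod (2 * m)) (y : ℂ) : Cmr m r j * y =
      (if j = (r : ZMod (2 * m)) then y else 0) -
        (if j = -(r : ZMod (2 * m)) then y else 0) := by
    unfold Cmr
    split_ifs with h1 h2
    · exact absurd (h1.symm.trans h2) hne
    all_goals simp
  have hpos : ZMod.toAddCircle (r : ZMod (2 * m)) = (x : UnitAddCircle) := by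
    rw [ZMod.toAddCircle_natCast, hxdef]
    push_cast
    rfl
  have hneg : ZMod.toAddCircle (-(r : ZMod (2 * m))) = ((1 - x : ℝ) : UnitAddCircle) := by
    rw [map_neg, hpos, AddCircle.coe_sub, AddCircle.coe_period, zero_sub]
  have hz {y : ℝ} (hy : y ∈ Ioo 0 1) : HurwitzZeta.hurwitzZeta y (-(2 * l : ℂ)) =
      -(2 * l).factorial * bernoulliCoeff y (2 * l + 1) := by
    have h := hurwitzZeta_neg_natCast hy (2 * l)
    push_cast at h
    rw [h, bernoulliCoeff, Nat.factorial_succ]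
    have h1 : (((2 * l).factorial : ℕ) : ℂ) ≠ 0 := Nat.cast_ne_zero.mpr (Nat.factorial_ne_zero _)
    have h2 : (2 * l + 1 : ℂ) ≠ 0 := by exact_mod_cast (2 * l).succ_ne_zero
    push_cast
    field_simp
  rw [ZMod.LFunction]
  simp only [hC, Finset.sum_sub_distrib, Finset.sum_ite_eq', Finset.mem_univ, if_true, neg_neg]
  rw [hpos, hneg, hz hx, hz hx', bernoulliCoeff_one_sub, (odd_two_mul_add_one l).neg_one_pow]
  have hpow : ((2 * m : ℕ) : ℂ) ^ (2 * l : ℂ) = (2 * m : ℂ) ^ (2 * l) := by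
    rw [← cpow_natCast]
    push_cast
    rfl
  rw [hpow]
  ring

end

/-- for `0 < r < m` and `|z| < π/m`,
`sinh((m−r)z)/sinh(mz) = Σ_ℓ L(−2ℓ, C_{m,r}) z^{2ℓ}/(2ℓ)!`. -/
theorem sinh_ratio_Lvalues (m r : ℕ) (hr : 0 < r) (hrm : r < m) :
    haveI : NeZero (2 * m) := ⟨by omega⟩
    ∀ z : ℂ, ‖z‖ < Real.pi / m →
      (Summable fun ℓ : ℕ =>
        ‖ZMod.LFunction (Cmr m r) (-(2 * ℓ : ℂ)) * z ^ (2 * ℓ) /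
          (((2 * ℓ).factorial : ℂ))‖) ∧
      (z ≠ 0 →
        Complex.sinh (((m : ℂ) - r) * z) / Complex.sinh ((m : ℂ) * z) =
          ∑' ℓ : ℕ, ZMod.LFunction (Cmr m r) (-(2 * ℓ : ℂ)) * z ^ (2 * ℓ) /
            (((2 * ℓ).factorial : ℂ))) := by
  have : NeZero (2 * m) := ⟨by lia⟩
  intro z hz
  have hm : (0 : ℝ) < m := by exact_mod_cast hr.trans hrm
  have hmC : (m : ℂ) ≠ 0 := by exact_mod_cast hm.ne'
  have hrm' : (r : ℝ) < m := by exact_mod_cast hrm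
  set x : ℝ := r / (2 * m) with hxdef
  have hx : x ∈ Set.Icc 0 1 := ⟨by positivity, (div_le_one (by positivity)).mpr (by linarith)⟩
  set w : ℂ := 2 * m * z with hwdef
  have hw : ‖w‖ < 2 * Real.pi := by
    rw [lt_div_iff₀ hm] at hz
    simp only [hwdef, norm_mul, Complex.norm_natCast, Complex.norm_ofNat]
    linarith
  have hterm (l : ℕ) : ZMod.LFunction (Cmr m r) (-(2 * l : ℂ)) * z ^ (2 * l) /
      ((2 * l).factorial : ℂ) = -2 * (bernoulliCoeff x (2 * l + 1) * w ^ (2 * l)) := by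
    have h1 : (((2 * l).factorial : ℕ) : ℂ) ≠ 0 := Nat.cast_ne_zero.mpr (Nat.factorial_ne_zero _)
    rw [LFunction_Cmr_neg_two_mul hr hrm, hwdef, mul_pow _ z, ← hxdef]
    field_simp
  simp only [hterm]
  constructor
  · have h := (summable_norm_bernoulliCoeff_add hx hw 1).comp_injective
      (mul_right_injective₀ (two_ne_zero (α := ℕ)))
    simpa only [norm_mul, Function.comp_def] using h.mul_left ‖(-2 : ℂ)‖
  · intro hz0
    have hw0 : w ≠ 0 := by simp [hwdef, hmC, hz0]
    have hexp : exp w ≠ 1 := by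
      rw [Ne, exp_eq_one_iff]
      rintro ⟨n, hn⟩
      have hn0 : n ≠ 0 := by
        rintro rfl
        simp [hw0] at hn
      have hn1 : (1 : ℝ) ≤ |(n : ℝ)| := by exact_mod_cast Int.one_le_abs hn0
      have : ‖w‖ = |(n : ℝ)| * (2 * Real.pi) := by
        rw [hn]
        simp [abs_of_pos Real.pi_pos]
      nlinarith [Real.pi_pos]
    have h := (hasSum_bernoulliCoeff_odd hx hw hexp).mul_left (-w⁻¹)
    have h' : HasSum (fun l ↦ -2 * (bernoulliCoeff x (2 * l + 1) * w ^ (2 * l)))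
        (-w⁻¹ * (w * (exp (x * w) - exp ((1 - x) * w)) / (exp w - 1))) :=
      h.congr_fun fun l ↦ by
        rw [pow_succ]
        field_simp
    rw [h'.tsum_eq]
    have hxw : (x : ℂ) * w = r * z := by
      rw [hxdef, hwdef]
      push_cast
      field_simp
    have hw2 : w = m * z + m * z := by rw [hwdef]; ring
    have hsinh : exp w - 1 = exp (m * z) * (2 * sinh (m * z)) := by
      rw [two_sinh, mul_sub, ← exp_add, ← exp_add, hw2, add_neg_cancel, exp_zero]
    have hnum : exp ((1 - x) * w) - exp (x * w) = exp (m * z) * (2 * sinh ((m - r) * z)) := by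
      rw [two_sinh, mul_sub, ← exp_add, ← exp_add, sub_mul, hxw, hw2]
      ring_nf
    have hs0 : sinh (m * z) ≠ 0 := by
      intro h0
      rw [h0, mul_zero, mul_zero, sub_eq_zero] at hsinh
      exact hexp hsinh
    have he0 := exp_ne_zero (m * z)
    rw [← neg_sub (exp ((1 - x) * w)), hnum, hsinh]
    field_simp
end

section
/- For every complex number q with |q| < 1, Σ_{n=1}^∞ ε₁₂(n) · q^{(n²−1)/24} = (1/2) · (1 − Σ_{n=1}^∞ (−1)^n q^{n(n−1)/2} / ∏_{k=1}^n (1 + q^k)), where ε₁₂(n) = 1 if n ≡ 1 or 7 (mod 12), ε₁₂(n) = −1 if n ≡ 5 or 11 (mod 12), and ε₁₂(n) = 0 otherwise; note that (n² − 1)/24 is a nonnegative integer whenever ε₁₂(n) ≠ 0, and both series converge absolutely. -/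
/-- `ε₁₂(n)`: `+1` if `n ≡ 1, 7 (mod 12)`, `−1` if `n ≡ 5, 11 (mod 12)`, else `0`. -/
def eps12 (n : ℕ) : ℤ :=
  if n % 12 = 1 ∨ n % 12 = 7 then 1
  else if n % 12 = 5 ∨ n % 12 = 11 then -1 else 0

/-- The `n`-th term `(−1)ⁿ q^{n(n+1)/2 + 2Nn} / (−q^{N+1}; q)_n` of a shifted family of
`q`-hypergeometric series. -/
noncomputable def shiftedTerm (q : ℂ) (N n : ℕ) : ℂ :=
  (-1) ^ n * q ^ ((n + 1) * n / 2 + 2 * N * n) / ∏ k ∈ Finset.range n, (1 + q ^ (N + k + 1))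

theorem succ_mul_div_two_succ (n : ℕ) :
    (n + 1 + 1) * (n + 1) / 2 = (n + 1) * n / 2 + (n + 1) := by
  have h : (n + 1 + 1) * (n + 1) = (n + 1) * n + 2 * (n + 1) := by ring
  omega

theorem one_sub_norm_le_norm_one_add_pow {q : ℂ} (hq : ‖q‖ < 1) (k : ℕ) :
    1 - ‖q‖ ≤ ‖1 + q ^ (k + 1)‖ := by
  have h1 : ‖q ^ (k + 1)‖ ≤ ‖q‖ := by
    rw [norm_pow]
    exact pow_le_of_le_one (norm_nonneg _) hq.le (Nat.succ_ne_zero k)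
  have h2 : ‖(1 : ℂ)‖ - ‖-q ^ (k + 1)‖ ≤ ‖1 - -q ^ (k + 1)‖ := norm_sub_norm_le _ _
  rw [norm_one, norm_neg, sub_neg_eq_add] at h2
  linarith

theorem one_add_pow_succ_ne_zero {q : ℂ} (hq : ‖q‖ < 1) (k : ℕ) : 1 + q ^ (k + 1) ≠ 0 := by
  have h := one_sub_norm_le_norm_one_add_pow hq k
  rw [← norm_pos_iff]
  linarith

theorem shiftedTerm_zero (q : ℂ) (N : ℕ) : shiftedTerm q N 0 = 1 := by
  simp [shiftedTerm]

theorem shiftedTerm_succ (q : ℂ) (N n : ℕ) :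
    shiftedTerm q N (n + 1) =
      -(shiftedTerm q N n * (q ^ (n + 1 + 2 * N) / (1 + q ^ (N + n + 1)))) := by
  have h : (n + 1 + 1) * (n + 1) / 2 + 2 * N * (n + 1) =
      ((n + 1) * n / 2 + 2 * N * n) + (n + 1 + 2 * N) := by
    rw [succ_mul_div_two_succ]; ring
  rw [shiftedTerm, shiftedTerm, h, Finset.prod_range_succ, pow_add q, pow_succ (-1 : ℂ),
    div_mul_div_comm, ← neg_div]
  congr 1
  ring

/-- Shifting `N` replaces `(−q^{N+1}; q)_n` by `(−q^{N+2}; q)_n`. -/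
theorem shiftedTerm_shift {q : ℂ} (hq : ‖q‖ < 1) (N n : ℕ) :
    shiftedTerm q (N + 1) n =
      shiftedTerm q N n * (q ^ (2 * n) * (1 + q ^ (N + 1)) / (1 + q ^ (N + n + 1))) := by
  induction n with
  | zero =>
    have := one_add_pow_succ_ne_zero hq N
    simp [shiftedTerm_zero, this]
  | succ n ih =>
    have h1 := one_add_pow_succ_ne_zero hq (N + n)
    have h2 := one_add_pow_succ_ne_zero hq (N + n + 1)
    rw [shiftedTerm_succ, shiftedTerm_succ, ih]
    rw [show N + 1 + n + 1 = N + n + 1 + 1 by ring, show N + (n + 1) + 1 = N + n + 1 + 1 by ring]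
    field_simp
    ring

theorem norm_shiftedTerm_le {q : ℂ} (hq : ‖q‖ < 1) (N n : ℕ) :
    ‖shiftedTerm q N n‖ ≤ ‖q‖ ^ ((n + 1) * n / 2) / (1 - ‖q‖) ^ n := by
  have hpos : 0 < 1 - ‖q‖ := by linarith
  rw [shiftedTerm, norm_div, norm_mul, norm_pow, norm_neg, norm_one, one_pow, one_mul, norm_pow,
    norm_prod]
  refine div_le_div₀ (by positivity) ?_ (by positivity) ?_
  · exact pow_le_pow_of_le_one (norm_nonneg _) hq.le (Nat.le_add_right _ _)
  · calc (1 - ‖q‖) ^ n = ∏ _k ∈ Finset.range n, (1 - ‖q‖) := by simp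
      _ ≤ _ := Finset.prod_le_prod (fun _ _ => hpos.le)
        fun k _ => one_sub_norm_le_norm_one_add_pow hq (N + k)

theorem summable_pow_triangle_div_pow {r : ℝ} (h0 : 0 ≤ r) (h1 : r < 1) :
    Summable fun n : ℕ => r ^ ((n + 1) * n / 2) / (1 - r) ^ n := by
  have hpos : 0 < 1 - r := by linarith
  have ht : Filter.Tendsto (fun n : ℕ => r ^ (n + 1) / (1 - r)) Filter.atTop (nhds 0) := by
    simpa using ((tendsto_pow_atTop_nhds_zero_of_lt_one h0 h1).comp
      (Filter.tendsto_add_atTop_nat 1)).div_const (1 - r)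
  refine summable_of_ratio_norm_eventually_le (r := 1 / 2) (by norm_num) ?_
  filter_upwards [ht.eventually (gt_mem_nhds (show (0 : ℝ) < 1 / 2 by norm_num))] with n hn
  have hx : 0 ≤ r ^ ((n + 1) * n / 2) / (1 - r) ^ n := by positivity
  rw [Real.norm_of_nonneg (by positivity), Real.norm_of_nonneg hx, succ_mul_div_two_succ,
    pow_add, pow_succ (1 - r), mul_div_mul_comm, mul_comm]
  exact mul_le_mul_of_nonneg_right hn.le hx

theorem summable_norm_shiftedTerm {q : ℂ} (hq : ‖q‖ < 1) (N : ℕ) :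
    Summable fun n => ‖shiftedTerm q N n‖ :=
  (summable_pow_triangle_div_pow (norm_nonneg q) hq).of_nonneg_of_le (fun _ => norm_nonneg _)
    (norm_shiftedTerm_le hq N)

theorem norm_tsum_shiftedTerm_le {q : ℂ} (hq : ‖q‖ < 1) (N : ℕ) :
    ‖∑' n, shiftedTerm q N n‖ ≤ ∑' n : ℕ, ‖q‖ ^ ((n + 1) * n / 2) / (1 - ‖q‖) ^ n :=
  tsum_of_norm_bounded (summable_pow_triangle_div_pow (norm_nonneg q) hq).hasSum
    (norm_shiftedTerm_le hq N)

theorem shiftedTerm_sub_telescope {q : ℂ} (hq : ‖q‖ < 1) (N n : ℕ) :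
    shiftedTerm q N n - q ^ (3 * N + 2) * shiftedTerm q (N + 1) n =
      shiftedTerm q N n * (1 - q ^ (2 * N + n + 1)) -
        shiftedTerm q N (n + 1) * (1 - q ^ (2 * N + (n + 1) + 1)) := by
  have h1 := one_add_pow_succ_ne_zero hq (N + n)
  rw [shiftedTerm_shift hq, shiftedTerm_succ]
  field_simp
  ring

/-- The limiting case of the Rogers–Fine recurrence. -/
theorem tsum_shiftedTerm_eq {q : ℂ} (hq : ‖q‖ < 1) (N : ℕ) :
    ∑' n, shiftedTerm q N n =
      1 - q ^ (2 * N + 1) + q ^ (3 * N + 2) * ∑' n, shiftedTerm q (N + 1) n := by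
  have hs := (summable_norm_shiftedTerm hq N).of_norm
  have hs' := (summable_norm_shiftedTerm hq (N + 1)).of_norm
  have hsum := (hs.hasSum.sub (hs'.hasSum.mul_left (q ^ (3 * N + 2)))).tendsto_sum_nat
  have hlim : Filter.Tendsto
      (fun m : ℕ => shiftedTerm q N 0 * (1 - q ^ (2 * N + 0 + 1)) -
        shiftedTerm q N m * (1 - q ^ (2 * N + m + 1)))
      Filter.atTop (nhds (shiftedTerm q N 0 * (1 - q ^ (2 * N + 0 + 1)) - 0 * (1 - 0))) := by
    refine tendsto_const_nhds.sub (hs.tendsto_atTop_zero.mul (tendsto_const_nhds.sub ?_))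
    refine ((tendsto_pow_atTop_nhds_zero_of_norm_lt_one hq).comp
      (Filter.tendsto_add_atTop_nat (2 * N + 1))).congr fun m => ?_
    rw [Function.comp_apply]
    congr 1
    ring
  have heq := tendsto_nhds_unique hsum (hlim.congr fun m => by
    rw [← Finset.sum_range_sub' (fun n => shiftedTerm q N n * (1 - q ^ (2 * N + n + 1)))]
    exact Finset.sum_congr rfl fun n _ => (shiftedTerm_sub_telescope hq N n).symm)
  rw [shiftedTerm_zero] at heq
  linear_combination heq

theorem pentagonal_succ (n : ℕ) :
    (n + 1) * (3 * (n + 1) + 1) / 2 = n * (3 * n + 1) / 2 + (3 * n + 2) := by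
  have h : (n + 1) * (3 * (n + 1) + 1) = n * (3 * n + 1) + 2 * (3 * n + 2) := by ring
  omega

theorem tsum_shiftedTerm_zero_eq_sum_add {q : ℂ} (hq : ‖q‖ < 1) (M : ℕ) :
    ∑' n, shiftedTerm q 0 n =
      ∑ j ∈ Finset.range M, q ^ (j * (3 * j + 1) / 2) * (1 - q ^ (2 * j + 1)) +
        q ^ (M * (3 * M + 1) / 2) * ∑' n, shiftedTerm q M n := by
  induction M with
  | zero => simp
  | succ M ih =>
    rw [ih, Finset.sum_range_succ, pentagonal_succ, tsum_shiftedTerm_eq hq M, pow_add q]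
    ring

theorem tendsto_sum_pentagonal {q : ℂ} (hq : ‖q‖ < 1) :
    Filter.Tendsto
      (fun M => ∑ j ∈ Finset.range M, q ^ (j * (3 * j + 1) / 2) * (1 - q ^ (2 * j + 1)))
      Filter.atTop (nhds (∑' n, shiftedTerm q 0 n)) := by
  have hexp : Filter.Tendsto (fun M : ℕ => M * (3 * M + 1) / 2) Filter.atTop Filter.atTop := by
    refine Filter.tendsto_atTop_mono (fun M => ?_) Filter.tendsto_id
    rw [id, Nat.le_div_iff_mul_le two_pos]
    nlinarith [Nat.le_mul_self M]
  have hrem : Filter.Tendsto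
      (fun M : ℕ => q ^ (M * (3 * M + 1) / 2) * ∑' n, shiftedTerm q M n)
      Filter.atTop (nhds 0) :=
    ((tendsto_pow_atTop_nhds_zero_of_norm_lt_one hq).comp hexp).zero_mul_isBoundedUnder_le
      (Filter.isBoundedUnder_of ⟨_, norm_tsum_shiftedTerm_le hq⟩)
  simpa using (tendsto_const_nhds.sub hrem).congr fun M => by
    rw [sub_eq_iff_eq_add]
    exact tsum_shiftedTerm_zero_eq_sum_add hq M

theorem norm_eps12_le (n : ℕ) : ‖(eps12 n : ℂ)‖ ≤ 1 := by
  unfold eps12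
  split_ifs <;> simp

theorem summable_norm_eps12_mul_pow {q : ℂ} (hq : ‖q‖ < 1) :
    Summable fun n : ℕ => ‖(eps12 (n + 1) : ℂ) * q ^ (((n + 1) ^ 2 - 1) / 24)‖ := by
  have hgeom : Summable fun n : ℕ => ‖q‖ ^ (n - 6) := by
    rw [← summable_nat_add_iff 6]
    simpa using summable_geometric_of_lt_one (norm_nonneg q) hq
  refine hgeom.of_nonneg_of_le (fun _ => norm_nonneg _) fun n => ?_
  have hexp : n - 6 ≤ ((n + 1) ^ 2 - 1) / 24 := by
    rw [Nat.le_div_iff_mul_le (by norm_num)]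
    have h : 24 * n ≤ n ^ 2 + 2 * n + 144 := by
      zify
      nlinarith [sq_nonneg ((n : ℤ) - 11)]
    have h' : (n + 1) ^ 2 = n ^ 2 + 2 * n + 1 := by ring
    omega
  calc ‖(eps12 (n + 1) : ℂ) * q ^ (((n + 1) ^ 2 - 1) / 24)‖
      = ‖(eps12 (n + 1) : ℂ)‖ * ‖q‖ ^ (((n + 1) ^ 2 - 1) / 24) := by rw [norm_mul, norm_pow]
    _ ≤ 1 * ‖q‖ ^ (n - 6) := mul_le_mul (norm_eps12_le _)
        (pow_le_pow_of_le_one (norm_nonneg _) hq.le hexp) (by positivity) zero_le_one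
    _ = ‖q‖ ^ (n - 6) := one_mul _

theorem eps12_one_mod_six (j : ℕ) : eps12 (6 * j + 1) = 1 := by
  rw [eps12, if_pos (by omega)]

theorem eps12_five_mod_six (j : ℕ) : eps12 (6 * j + 5) = -1 := by
  rw [eps12, if_neg (by omega), if_pos (by omega)]

theorem eps12_eq_zero {n : ℕ} (h1 : n % 6 ≠ 1) (h5 : n % 6 ≠ 5) : eps12 n = 0 := by
  rw [eps12, if_neg (by omega), if_neg (by omega)]

theorem sum_range_six_mul_eps12 (q : ℂ) (M : ℕ) :
    ∑ n ∈ Finset.range (6 * M), (eps12 (n + 1) : ℂ) * q ^ (((n + 1) ^ 2 - 1) / 24) =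
      ∑ j ∈ Finset.range M, q ^ (j * (3 * j + 1) / 2) * (1 - q ^ (2 * j + 1)) := by
  induction M with
  | zero => simp
  | succ j ih =>
    have e1 : ((6 * j + 1) ^ 2 - 1) / 24 = j * (3 * j + 1) / 2 := by
      have h : (6 * j + 1) ^ 2 = 12 * (j * (3 * j + 1)) + 1 := by ring
      omega
    have e5 : ((6 * j + 5) ^ 2 - 1) / 24 = j * (3 * j + 1) / 2 + (2 * j + 1) := by
      have h : (6 * j + 5) ^ 2 = 12 * (j * (3 * j + 1)) + 24 * (2 * j + 1) + 1 := by ring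
      omega
    rw [Finset.sum_range_succ, ← ih, show 6 * (j + 1) = 6 * j + 1 + 1 + 1 + 1 + 1 + 1 by ring]
    iterate 6 rw [Finset.sum_range_succ]
    rw [eps12_one_mod_six, eps12_eq_zero (n := 6 * j + 1 + 1) (by omega) (by omega),
      eps12_eq_zero (n := 6 * j + 1 + 1 + 1) (by omega) (by omega),
      eps12_eq_zero (n := 6 * j + 1 + 1 + 1 + 1) (by omega) (by omega),
      show 6 * j + 1 + 1 + 1 + 1 + 1 = 6 * j + 5 by ring, eps12_five_mod_six,
      eps12_eq_zero (n := 6 * j + 5 + 1) (by omega) (by omega), e1, e5, pow_add q]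
    push_cast
    ring

theorem tsum_eps12_mul_pow {q : ℂ} (hq : ‖q‖ < 1) :
    ∑' n : ℕ, (eps12 (n + 1) : ℂ) * q ^ (((n + 1) ^ 2 - 1) / 24) =
      ∑' n, shiftedTerm q 0 n := by
  have hlim := (summable_norm_eps12_mul_pow hq).of_norm.hasSum.tendsto_sum_nat.comp
    (Filter.tendsto_id.const_mul_atTop' (show 0 < 6 by norm_num))
  exact tendsto_nhds_unique (hlim.congr fun M => sum_range_six_mul_eps12 q M)
    (tendsto_sum_pentagonal hq)

theorem qHypergeometric_term_eq {q : ℂ} (hq : ‖q‖ < 1) (n : ℕ) :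
    (-1 : ℂ) ^ (n + 1) * q ^ ((n + 1) * n / 2) / ∏ k ∈ Finset.range (n + 1), (1 + q ^ (k + 1)) =
      -shiftedTerm q 0 n - shiftedTerm q 0 (n + 1) := by
  have h := one_add_pow_succ_ne_zero hq n
  have hterm : (-1 : ℂ) ^ (n + 1) * q ^ ((n + 1) * n / 2) /
      ∏ k ∈ Finset.range (n + 1), (1 + q ^ (k + 1)) =
        -(shiftedTerm q 0 n / (1 + q ^ (n + 1))) := by
    rw [shiftedTerm, Finset.prod_range_succ, div_div, ← neg_div]
    simp [pow_succ]
  rw [hterm, shiftedTerm_succ]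
  simp only [Nat.mul_zero, Nat.add_zero, Nat.zero_add]
  field_simp
  ring

/-- the false theta function `q^{−1/24}Ψ^{6+2}_1` as a
`q`-hypergeometric series:
`Σ_{n≥1} ε₁₂(n) q^{(n²−1)/24} = (1/2)(1 − Σ_{n≥1} (−1)ⁿ q^{n(n−1)/2}/(−q;q)_n)`. -/
theorem falseTheta_6_2_qHypergeometric (q : ℂ) (hq : ‖q‖ < 1) :
    (Summable fun n : ℕ =>
      ‖(eps12 (n + 1) : ℂ) * q ^ (((n + 1) ^ 2 - 1) / 24)‖) ∧
    (Summable fun n : ℕ =>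
      ‖(-1 : ℂ) ^ (n + 1) * q ^ ((n + 1) * n / 2) /
        ∏ k ∈ Finset.range (n + 1), (1 + q ^ (k + 1))‖) ∧
    ∑' n : ℕ, (eps12 (n + 1) : ℂ) * q ^ (((n + 1) ^ 2 - 1) / 24) =
      (1 / 2) * (1 - ∑' n : ℕ, (-1 : ℂ) ^ (n + 1) * q ^ ((n + 1) * n / 2) /
        ∏ k ∈ Finset.range (n + 1), (1 + q ^ (k + 1))) := by
  have hs := summable_norm_shiftedTerm hq 0
  have hs' := (summable_nat_add_iff 1).mpr hs
  refine ⟨summable_norm_eps12_mul_pow hq, ?_, ?_⟩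
  · simp_rw [qHypergeometric_term_eq hq]
    refine (hs.add hs').of_nonneg_of_le (fun _ => norm_nonneg _) fun n => ?_
    simpa using norm_sub_le (-shiftedTerm q 0 n) (shiftedTerm q 0 (n + 1))
  · simp_rw [qHypergeometric_term_eq hq]
    rw [tsum_eps12_mul_pow hq, hs.of_norm.neg.tsum_sub hs'.of_norm, tsum_neg]
    have h := hs.of_norm.tsum_eq_zero_add
    rw [shiftedTerm_zero] at h
    linear_combination (1 / 2) * h
end

section
/- For every complex number q with |q| < 1, Σ_{n=1}^∞ ε₂₀(n) · q^{(n²−1)/40} = Σ_{n=0}^∞ (−1)^n q^{n(n+1)} / ∏_{k=1}^{2n} (1 + q^k), where ε₂₀(n) = 1 if n ≡ 1 or 11 (mod 20), ε₂₀(n) = −1 if n ≡ 9 or 19 (mod 20), and ε₂₀(n) = 0 otherwise; note that (n² − 1)/40 is a nonnegative integer whenever ε₂₀(n) ≠ 0, and both series converge absolutely. -/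
/-- `ε₂₀(n)`: `+1` if `n ≡ 1, 11 (mod 20)`, `−1` if `n ≡ 9, 19 (mod 20)`, else `0`. -/
def eps20 (n : ℕ) : ℤ :=
  if n % 20 = 1 ∨ n % 20 = 11 then 1
  else if n % 20 = 9 ∨ n % 20 = 19 then -1 else 0

open Filter Topology

/-- The `q`-Pochhammer symbol `(q²; q²)_n`. -/
noncomputable def qpSq (q : ℂ) (n : ℕ) : ℂ := ∏ k ∈ Finset.range n, (1 - q ^ (2 * (k + 1)))

/-- The function `k ↦ 1 / (q²; q²)_k` on the integers, which is `0` for negative `k`. -/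
noncomputable def qpSqInv (q : ℂ) (k : ℤ) : ℂ := if k < 0 then 0 else (qpSq q k.toNat)⁻¹

/-- The generalized pentagonal number `r (3 r - 1) / 2`. -/
def pent (r : ℤ) : ℤ := r * (3 * r - 1) / 2

/-- The bilateral sum `∑ (-1)^r q^{r(3r-1)/2 + kr} / ((q²; q²)_{a-r} (q²; q²)_{b+r})`. -/
noncomputable def thetaSum (q : ℂ) (a b k : ℤ) : ℂ :=
  ∑' r : ℤ, (-1) ^ r * q ^ (pent r + k * r) * qpSqInv q (a - r) * qpSqInv q (b + r)

lemma one_sub_pow_ne_zero {q : ℂ} (hq : ‖q‖ < 1) {n : ℕ} (hn : n ≠ 0) : 1 - q ^ n ≠ 0 := by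
  intro h
  have h1 : ‖q ^ n‖ < 1 := by
    rw [norm_pow]; exact pow_lt_one₀ (norm_nonneg _) hq hn
  rw [← sub_eq_zero.mp h] at h1
  simp at h1

lemma one_add_pow_ne_zero {q : ℂ} (hq : ‖q‖ < 1) {n : ℕ} (hn : n ≠ 0) : 1 + q ^ n ≠ 0 := by
  intro h
  have h1 : ‖q ^ n‖ < 1 := by
    rw [norm_pow]; exact pow_lt_one₀ (norm_nonneg _) hq hn
  rw [← neg_eq_of_add_eq_zero_right h] at h1
  simp at h1

lemma qpSq_zero (q : ℂ) : qpSq q 0 = 1 := by simp [qpSq]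

lemma qpSq_succ (q : ℂ) (n : ℕ) : qpSq q (n + 1) = qpSq q n * (1 - q ^ (2 * (n + 1))) := by
  simp [qpSq, Finset.prod_range_succ]

lemma qpSq_ne_zero {q : ℂ} (hq : ‖q‖ < 1) (n : ℕ) : qpSq q n ≠ 0 :=
  Finset.prod_ne_zero_iff.mpr fun _ _ => one_sub_pow_ne_zero hq (by lia)

lemma qpSqInv_natCast (q : ℂ) (n : ℕ) : qpSqInv q n = (qpSq q n)⁻¹ := by
  simp [qpSqInv]

lemma qpSqInv_of_neg (q : ℂ) {k : ℤ} (hk : k < 0) : qpSqInv q k = 0 := by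
  simp [qpSqInv, hk]

lemma qpSqInv_sub_one {q : ℂ} (hq : ‖q‖ < 1) (k : ℤ) :
    qpSqInv q (k - 1) = (1 - q ^ (2 * k)) * qpSqInv q k := by
  rcases lt_trichotomy k 0 with h | rfl | h
  · rw [qpSqInv_of_neg q h, qpSqInv_of_neg q (by lia), mul_zero]
  · rw [qpSqInv_of_neg q (by lia)]; simp
  · obtain ⟨n, rfl⟩ : ∃ n : ℕ, k = (n + 1 : ℕ) := ⟨(k - 1).toNat, by lia⟩
    have e : q ^ (2 * ((n + 1 : ℕ) : ℤ)) = q ^ (2 * (n + 1)) := by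
      rw [← zpow_natCast]; push_cast; rfl
    rw [show ((n + 1 : ℕ) : ℤ) - 1 = (n : ℤ) by push_cast; ring, qpSqInv_natCast,
      qpSqInv_natCast, qpSq_succ, e]
    have := qpSq_ne_zero hq n
    have := one_sub_pow_ne_zero hq (n := 2 * (n + 1)) (by lia)
    field_simp

lemma two_mul_pent (r : ℤ) : 2 * pent r = r * (3 * r - 1) := by
  refine Int.mul_ediv_cancel' (even_iff_two_dvd.mp ?_)
  rcases Int.even_or_odd r with h | h
  · exact h.mul_right _
  · exact Even.mul_left (by grind) _

lemma pent_neg (r : ℤ) : pent (-r) = pent r + r := by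
  linarith [two_mul_pent r, two_mul_pent (-r)]

lemma pent_add_one (r : ℤ) : pent (r + 1) = pent r + 3 * r + 1 := by
  linarith [two_mul_pent r, two_mul_pent (r + 1)]

lemma summable_thetaSum (q : ℂ) (a b k : ℤ) : Summable fun r : ℤ =>
    (-1) ^ r * q ^ (pent r + k * r) * qpSqInv q (a - r) * qpSqInv q (b + r) := by
  refine summable_of_hasFiniteSupport ((Set.finite_Icc (-b) a).subset fun r hr => ?_)
  rw [Function.mem_support] at hr
  constructor
  · by_contra h
    exact hr (by rw [qpSqInv_of_neg q (k := b + r) (by lia), mul_zero])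
  · by_contra h
    exact hr (by rw [qpSqInv_of_neg q (k := a - r) (by lia), mul_zero, zero_mul])

lemma thetaSum_sub_one_left {q : ℂ} (hq : ‖q‖ < 1) (h0 : q ≠ 0) (a b k : ℤ) :
    thetaSum q (a - 1) b k = thetaSum q a b k - q ^ (2 * a) * thetaSum q a b (k - 2) := by
  unfold thetaSum
  rw [← tsum_mul_left, ← (summable_thetaSum q a b k).tsum_sub
    ((summable_thetaSum q a b (k - 2)).mul_left _)]
  congr 1 with r
  rw [show a - 1 - r = (a - r) - 1 by ring, qpSqInv_sub_one hq,
    show pent r + k * r = (pent r + (k - 2) * r) + r + r by ring,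
    show 2 * (a - r) = 2 * a - r - r by ring]
  simp only [zpow_add₀ h0, zpow_sub₀ h0]
  field_simp

lemma thetaSum_sub_one_right {q : ℂ} (hq : ‖q‖ < 1) (h0 : q ≠ 0) (a b k : ℤ) :
    thetaSum q a (b - 1) k = thetaSum q a b k - q ^ (2 * b) * thetaSum q a b (k + 2) := by
  unfold thetaSum
  rw [← tsum_mul_left, ← (summable_thetaSum q a b k).tsum_sub
    ((summable_thetaSum q a b (k + 2)).mul_left _)]
  congr 1 with r
  rw [show b - 1 + r = (b + r) - 1 by ring, qpSqInv_sub_one hq,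
    show pent r + (k + 2) * r = (pent r + k * r) + r + r by ring,
    show 2 * (b + r) = 2 * b + r + r by ring]
  simp only [zpow_add₀ h0]
  ring

lemma thetaSum_swap (q : ℂ) (a b k : ℤ) : thetaSum q a b k = thetaSum q b a (1 - k) := by
  unfold thetaSum
  rw [← (Equiv.neg ℤ).tsum_eq]
  congr 1 with r
  simp only [Equiv.neg_apply, pent_neg]
  rw [show pent r + r + k * -r = pent r + (1 - k) * r by ring, sub_neg_eq_add, ← sub_eq_add_neg,
    show (-1 : ℂ) ^ (-r) = (-1) ^ r by rw [zpow_neg, ← inv_zpow]; norm_num]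
  ring

lemma thetaSum_shift {q : ℂ} (h0 : q ≠ 0) (a b k : ℤ) :
    thetaSum q a b k = -q ^ (k + 1) * thetaSum q (a - 1) (b + 1) (k + 3) := by
  unfold thetaSum
  rw [← (Equiv.addRight (1 : ℤ)).tsum_eq, ← tsum_mul_left]
  congr 1 with r
  simp only [Equiv.coe_addRight, pent_add_one]
  rw [show pent r + 3 * r + 1 + k * (r + 1) = (k + 1) + (pent r + (k + 3) * r) by ring,
    zpow_add₀ h0, zpow_add_one₀ (by norm_num), show a - (r + 1) = a - 1 - r by ring,
    show b + (r + 1) = b + 1 + r by ring]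
  ring

lemma thetaSum_pascal_right {q : ℂ} (hq : ‖q‖ < 1) (h0 : q ≠ 0) (a b k : ℤ) :
    (1 - q ^ (2 * (a + b))) * thetaSum q a b k =
      thetaSum q a (b - 1) k + q ^ (2 * b) * thetaSum q (a - 1) b (k + 2) := by
  rw [thetaSum_sub_one_left hq h0, thetaSum_sub_one_right hq h0, mul_add, zpow_add₀ h0,
    show k + 2 - 2 = k by ring]
  ring

lemma thetaSum_pascal_left {q : ℂ} (hq : ‖q‖ < 1) (h0 : q ≠ 0) (a b k : ℤ) :
    (1 - q ^ (2 * (a + b))) * thetaSum q a b k =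
      thetaSum q (a - 1) b k + q ^ (2 * a) * thetaSum q a (b - 1) (k - 2) := by
  rw [thetaSum_sub_one_left hq h0, thetaSum_sub_one_right hq h0, mul_add, zpow_add₀ h0,
    show k - 2 + 2 = k by ring]
  ring

lemma thetaSum_zero (q : ℂ) (k : ℤ) : thetaSum q 0 0 k = 1 := by
  unfold thetaSum
  rw [tsum_eq_single 0]
  · simp [pent, qpSqInv, qpSq_zero]
  · intro r hr
    rcases lt_or_gt_of_ne hr with h | h
    · rw [qpSqInv_of_neg q (k := 0 + r) (by lia), mul_zero]
    · rw [qpSqInv_of_neg q (k := 0 - r) (by lia), mul_zero, zero_mul]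

lemma thetaSum_succ_one {q : ℂ} (hq : ‖q‖ < 1) (h0 : q ≠ 0) (n : ℕ) :
    (1 + q ^ (2 * n + 1)) * thetaSum q n (n + 1) 1 = thetaSum q n n 0 := by
  have h1 := thetaSum_pascal_right hq h0 n (n + 1) 1
  have h2 := thetaSum_swap q n n 1
  have h3 := thetaSum_shift h0 n n 0
  have e1 : q ^ (2 * ((n : ℤ) + (n + 1))) = (q ^ (2 * n + 1)) ^ 2 := by
    rw [← pow_mul, ← zpow_natCast]; congr 1; push_cast; ring
  have e2 : q ^ (2 * ((n : ℤ) + 1)) = q ^ (2 * n + 1) * q := by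
    rw [← pow_succ, ← zpow_natCast]; congr 1
  rw [e1, e2] at h1
  norm_num at h1 h2 h3
  have h4 := one_sub_pow_ne_zero hq (n := 2 * n + 1) (by lia)
  apply mul_left_cancel₀ h4
  linear_combination h1 + h2 + q ^ (2 * n + 1) * h3

lemma thetaSum_diag_succ_neg_one {q : ℂ} (hq : ‖q‖ < 1) (h0 : q ≠ 0) (n : ℕ) :
    (1 - q ^ (4 * n + 4)) * thetaSum q (n + 1) (n + 1) (-1) =
      q ^ (2 * n + 2) * thetaSum q n (n + 1) 1 := by
  have h1 := thetaSum_pascal_right hq h0 (n + 1) (n + 1) (-1)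
  have h2 := thetaSum_swap q n (n + 1) 2
  have h3 := thetaSum_shift h0 (n + 1) n (-1)
  have e1 : q ^ (2 * ((n : ℤ) + 1 + (n + 1))) = q ^ (4 * n + 4) := by
    rw [← zpow_natCast]; congr 1; push_cast; ring
  have e2 : q ^ (2 * ((n : ℤ) + 1)) = q ^ (2 * n + 2) := by
    rw [← zpow_natCast]; congr 1
  rw [e1, e2] at h1
  norm_num at h1 h2 h3
  linear_combination h1 + h3 / 2 - h2 / 2

lemma thetaSum_succ_zero {q : ℂ} (hq : ‖q‖ < 1) (h0 : q ≠ 0) (n : ℕ) :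
    (1 - q ^ (4 * n + 2)) * thetaSum q n (n + 1) 0 =
      thetaSum q n n 0 - q ^ (2 * n + 2) * thetaSum q n n (-1) := by
  have h1 := thetaSum_pascal_right hq h0 n (n + 1) 0
  have h3 := thetaSum_shift h0 n n (-1)
  have e1 : q ^ (2 * ((n : ℤ) + (n + 1))) = q ^ (4 * n + 2) := by
    rw [← zpow_natCast]; congr 1; push_cast; ring
  have e2 : q ^ (2 * ((n : ℤ) + 1)) = q ^ (2 * n + 2) := by
    rw [← zpow_natCast]; congr 1
  rw [e1, e2] at h1
  norm_num at h1 h3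
  linear_combination h1 + q ^ (2 * n + 2) * h3

lemma thetaSum_diag_succ_zero {q : ℂ} (hq : ‖q‖ < 1) (h0 : q ≠ 0) (n : ℕ) :
    (1 - q ^ (4 * n + 4)) * thetaSum q (n + 1) (n + 1) 0 =
      thetaSum q n (n + 1) 0 - q ^ (2 * n + 1) * thetaSum q n (n + 1) 1 := by
  have h1 := thetaSum_pascal_left hq h0 (n + 1) (n + 1) 0
  have h3 := thetaSum_shift h0 (n + 1) n (-2)
  have e1 : q ^ (2 * ((n : ℤ) + 1 + (n + 1))) = q ^ (4 * n + 4) := by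
    rw [← zpow_natCast]; congr 1; push_cast; ring
  have e2 : q ^ (2 * ((n : ℤ) + 1)) = q ^ (2 * n + 1) * q := by
    rw [← pow_succ, ← zpow_natCast]; congr 1
  rw [e1, e2] at h1
  norm_num at h1 h3
  rw [h1, h3]
  field_simp
  ring

lemma thetaSum_diag {q : ℂ} (hq : ‖q‖ < 1) (h0 : q ≠ 0) (n : ℕ) :
    thetaSum q n n (-1) = q ^ (2 * n) * thetaSum q n n 0 ∧
      thetaSum q n (n + 1) 0 = thetaSum q n n 0 ∧
      thetaSum q n n 0 * ((∏ k ∈ Finset.range (2 * n), (1 + q ^ (k + 1))) * qpSq q n) = 1 := by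
  have hW (n : ℕ) (hX : thetaSum q n n (-1) = q ^ (2 * n) * thetaSum q n n 0) :
      thetaSum q n (n + 1) 0 = thetaSum q n n 0 := by
    apply mul_left_cancel₀ (one_sub_pow_ne_zero hq (n := 4 * n + 2) (by lia))
    rw [thetaSum_succ_zero hq h0, hX]
    ring
  induction n with
  | zero =>
    have h := hW 0 (by simp [thetaSum_zero])
    simp only [Nat.cast_zero, zero_add] at h ⊢
    simp [h, thetaSum_zero, qpSq_zero]
  | succ n ih =>
    obtain ⟨-, h2, h3⟩ := ih
    have hw := thetaSum_succ_one hq h0 n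
    have hx := thetaSum_diag_succ_neg_one hq h0 n
    have hv := thetaSum_diag_succ_zero hq h0 n
    have n1 := one_sub_pow_ne_zero hq (n := 4 * n + 4) (by lia)
    have hv' : (1 - q ^ (4 * n + 4)) * thetaSum q (n + 1) (n + 1) 0 = thetaSum q n (n + 1) 1 := by
      rw [hv, h2]; linear_combination -hw
    have hX : thetaSum q (n + 1 : ℕ) (n + 1 : ℕ) (-1) =
        q ^ (2 * (n + 1)) * thetaSum q (n + 1 : ℕ) (n + 1 : ℕ) 0 := by
      apply mul_left_cancel₀ n1
      push_cast
      rw [hx]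
      linear_combination -q ^ (2 * n + 2) * hv'
    refine ⟨hX, mod_cast hW (n + 1) hX, ?_⟩
    rw [show 2 * (n + 1) = 2 * n + 1 + 1 by ring, Finset.prod_range_succ, Finset.prod_range_succ,
      qpSq_succ]
    push_cast
    rw [← hw, ← hv'] at h3
    linear_combination h3

lemma exists_norm_prod_one_add_le {f : ℕ → ℂ} (hf : Summable fun n => ‖f n‖)
    (h0 : ∀ n, 1 + f n ≠ 0) : ∃ C : ℝ, 0 ≤ C ∧ ∃ L : ℂ, L ≠ 0 ∧
      Tendsto (fun n => ∏ k ∈ Finset.range n, (1 + f k)) atTop (𝓝 L) ∧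
      ∀ n, ‖∏ k ∈ Finset.range n, (1 + f k)‖ ≤ C ∧ ‖(∏ k ∈ Finset.range n, (1 + f k))⁻¹‖ ≤ C := by
  have hL := tprod_one_add_ne_zero_of_summable h0 hf
  have ht := (multipliable_one_add_of_summable hf).hasProd.tendsto_prod_nat
  obtain ⟨C₁, hC₁⟩ := (Metric.isBounded_range_of_tendsto _ ht).exists_norm_le
  obtain ⟨C₂, hC₂⟩ := (Metric.isBounded_range_of_tendsto _ (ht.inv₀ hL)).exists_norm_le
  refine ⟨max C₁ C₂, ?_, _, hL, ht, fun n => ⟨?_, ?_⟩⟩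
  · exact ((norm_nonneg _).trans (hC₁ _ ⟨0, rfl⟩)).trans (le_max_left _ _)
  · exact (hC₁ _ ⟨n, rfl⟩).trans (le_max_left _ _)
  · exact (hC₂ _ ⟨n, rfl⟩).trans (le_max_right _ _)

lemma exists_norm_qpSq_le {q : ℂ} (hq : ‖q‖ < 1) : ∃ C : ℝ, 0 ≤ C ∧ ∃ L : ℂ, L ≠ 0 ∧
    Tendsto (qpSq q) atTop (𝓝 L) ∧ ∀ n, ‖qpSq q n‖ ≤ C ∧ ‖(qpSq q n)⁻¹‖ ≤ C := by
  have hs : Summable fun n : ℕ => ‖-q ^ (2 * (n + 1))‖ := by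
    refine (summable_geometric_of_lt_one (norm_nonneg q) hq).of_nonneg_of_le
      (fun _ => norm_nonneg _) fun n => ?_
    rw [norm_neg, norm_pow]
    exact pow_le_pow_of_le_one (norm_nonneg q) hq.le (by lia)
  have h := exists_norm_prod_one_add_le hs
    fun n => by rw [← sub_eq_add_neg]; exact one_sub_pow_ne_zero hq (by lia)
  simp only [← sub_eq_add_neg] at h
  exact h

/-- The summand of the limiting `q`-Gauss series in base `q²`. -/
noncomputable def gaussTerm (q : ℂ) (A D m : ℕ) : ℂ :=
  (-1) ^ m * q ^ (m * (m + 1) + 2 * D * m) * qpSq q (A + m) * (qpSq q m)⁻¹ *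
    (qpSq q (A + D + m + 1))⁻¹

lemma exists_norm_gaussTerm_le {q : ℂ} (hq : ‖q‖ < 1) :
    ∃ C : ℝ, 0 ≤ C ∧ ∀ A D m, ‖gaussTerm q A D m‖ ≤ C * ‖q‖ ^ (m * (m + 1) + 2 * D * m) := by
  obtain ⟨C, hC0, -, -, -, hC⟩ := exists_norm_qpSq_le hq
  refine ⟨C * C * C, by positivity, fun A D m => ?_⟩
  have h1 := (hC (A + m)).1
  have h2 := (hC m).2
  have h3 := (hC (A + D + m + 1)).2
  calc ‖gaussTerm q A D m‖ = ‖qpSq q (A + m)‖ * ‖(qpSq q m)⁻¹‖ * ‖(qpSq q (A + D + m + 1))⁻¹‖ *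
        ‖q‖ ^ (m * (m + 1) + 2 * D * m) := by
        simp only [gaussTerm, norm_mul, norm_pow, norm_neg, norm_one, one_pow]; ring
    _ ≤ _ := by gcongr

lemma summable_gaussTerm {q : ℂ} (hq : ‖q‖ < 1) (A D : ℕ) : Summable (gaussTerm q A D) := by
  obtain ⟨C, hC0, hC⟩ := exists_norm_gaussTerm_le hq
  refine Summable.of_norm_bounded
    ((summable_geometric_of_lt_one (norm_nonneg q) hq).mul_left C) fun m => (hC A D m).trans ?_
  exact mul_le_mul_of_nonneg_left
    (pow_le_pow_of_le_one (norm_nonneg q) hq.le (by nlinarith [Nat.zero_le (2 * D * m)])) hC0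

lemma gaussTerm_telescope {q : ℂ} (hq : ‖q‖ < 1) (A D m : ℕ) :
    gaussTerm q A D m = (1 - q ^ (2 * (D + 1))) * gaussTerm q A (D + 1) m +
      (gaussTerm q A D m * (1 - q ^ (2 * m)) -
        gaussTerm q A D (m + 1) * (1 - q ^ (2 * (m + 1)))) := by
  have h1 := qpSq_ne_zero hq m
  have h2 := qpSq_ne_zero hq (A + D + m + 1)
  have h3 := one_sub_pow_ne_zero hq (n := 2 * (m + 1)) (by lia)
  have h4 := one_sub_pow_ne_zero hq (n := 2 * (A + D + m + 1 + 1)) (by lia)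
  obtain ⟨E, hE⟩ : ∃ E, E = m * (m + 1) + 2 * D * m := ⟨_, rfl⟩
  unfold gaussTerm
  rw [show A + (D + 1) + m + 1 = A + D + m + 1 + 1 by ring,
    show A + D + (m + 1) + 1 = A + D + m + 1 + 1 by ring, ← add_assoc A m 1,
    qpSq_succ q (A + D + m + 1), qpSq_succ q m, qpSq_succ q (A + m),
    show m * (m + 1) + 2 * (D + 1) * m = E + 2 * m by rw [hE]; ring,
    show (m + 1) * (m + 1 + 1) + 2 * D * (m + 1) = E + (2 * m + 2 * D + 2) by rw [hE]; ring,
    ← hE, pow_add q E, pow_add q E]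
  field_simp
  ring

lemma tsum_gaussTerm_succ {q : ℂ} (hq : ‖q‖ < 1) (A D : ℕ) :
    ∑' m, gaussTerm q A D m = (1 - q ^ (2 * (D + 1))) * ∑' m, gaussTerm q A (D + 1) m := by
  have hs := summable_gaussTerm hq A D
  have hs' := summable_gaussTerm hq A (D + 1)
  have hv : Summable fun m => gaussTerm q A D m * (1 - q ^ (2 * m)) := by
    refine Summable.of_norm_bounded (hs.norm.mul_right 2) fun m => ?_
    rw [norm_mul]
    refine mul_le_mul_of_nonneg_left ((norm_sub_le _ _).trans ?_) (norm_nonneg _)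
    rw [norm_one, norm_pow]
    linarith [pow_le_one₀ (n := 2 * m) (norm_nonneg q) hq.le]
  have hv' := (summable_nat_add_iff 1).mpr hv
  have h0 := hv.tsum_eq_zero_add
  simp only [mul_zero, pow_zero, sub_self, zero_add] at h0
  rw [tsum_congr (gaussTerm_telescope hq A D), (hs'.mul_left _).tsum_add (hv.sub hv'),
    hv.tsum_sub hv', h0, sub_self, add_zero, tsum_mul_left]

lemma qpSq_mul_tsum_gaussTerm {q : ℂ} (hq : ‖q‖ < 1) (A D : ℕ) :
    qpSq q D * ∑' m, gaussTerm q A D m = qpSq q A := by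
  have hconst (D : ℕ) : qpSq q D * ∑' m, gaussTerm q A D m = ∑' m, gaussTerm q A 0 m := by
    induction D with
    | zero => rw [qpSq_zero, one_mul]
    | succ D ih => rw [← ih, tsum_gaussTerm_succ hq A D, qpSq_succ]; ring
  obtain ⟨-, -, L, hL, hlim, -⟩ := exists_norm_qpSq_le hq
  obtain ⟨C, hC0, hC⟩ := exists_norm_gaussTerm_le hq
  have hT : Tendsto (fun D => ∑' m, gaussTerm q A D m) atTop
      (𝓝 (∑' m : ℕ, if m = 0 then qpSq q A * L⁻¹ else 0)) := by
    refine tendsto_tsum_of_dominated_convergence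
      ((summable_geometric_of_lt_one (norm_nonneg q) hq).mul_left C) (fun m => ?_)
      (Eventually.of_forall fun D m => (hC A D m).trans ?_)
    · rcases eq_or_ne m 0 with rfl | hm
      · simp only [gaussTerm, if_true, qpSq_zero]
        simp only [pow_zero, mul_zero, zero_mul, add_zero, one_mul, inv_one, mul_one]
        refine ((hlim.inv₀ hL).comp (tendsto_atTop_mono (fun D => ?_) tendsto_id)).const_mul _
        simp only [id]; lia
      · rw [if_neg hm]
        refine squeeze_zero_norm (a := fun D => C * ‖q‖ ^ D) (fun D => (hC A D m).trans ?_) ?_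
        · refine mul_le_mul_of_nonneg_left
            (pow_le_pow_of_le_one (norm_nonneg q) hq.le ?_) hC0
          nlinarith [Nat.pos_of_ne_zero hm, Nat.zero_le (m * (m + 1)),
            Nat.mul_le_mul_left D (Nat.pos_of_ne_zero hm)]
        · simpa using (tendsto_pow_atTop_nhds_zero_of_lt_one (norm_nonneg q) hq).const_mul C
    · exact mul_le_mul_of_nonneg_left (pow_le_pow_of_le_one (norm_nonneg q) hq.le
        (by nlinarith [Nat.zero_le (2 * D * m)])) hC0
  rw [tsum_ite_eq] at hT
  have h := hlim.mul hT
  simp only [hconst] at h ⊢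
  rw [tendsto_nhds_unique tendsto_const_nhds h]
  field_simp

lemma pent_natCast_nonneg (r : ℕ) : 0 ≤ pent r := by
  have := two_mul_pent r
  rcases Nat.eq_zero_or_pos r with rfl | h
  · simp [pent]
  · have : (0 : ℤ) ≤ r * (3 * r - 1) := mul_nonneg (by lia) (by lia)
    lia

lemma coe_toNat_pent (r : ℕ) : ((pent r).toNat : ℤ) = pent r :=
  Int.toNat_of_nonneg (pent_natCast_nonneg r)

/-- The summand of the double series that links both sides. -/
noncomputable def doubleTerm (q : ℂ) (r n : ℕ) : ℂ :=
  (-1) ^ r * q ^ (pent r).toNat * (1 - q ^ (4 * r + 2)) *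
    ((-1) ^ n * q ^ (n * (n + 1)) * qpSq q n * qpSqInv q (n - r) * qpSqInv q (n + 1 + r))

lemma inv_prod_one_add_eq_tsum {q : ℂ} (hq : ‖q‖ < 1) (n : ℕ) :
    (∏ k ∈ Finset.range (2 * n), (1 + q ^ (k + 1)))⁻¹ =
      qpSq q n * ∑' r : ℕ, (-1) ^ r * q ^ (pent r).toNat * (1 - q ^ (4 * r + 2)) *
        (qpSqInv q (n - r) * qpSqInv q (n + 1 + r)) := by
  rcases eq_or_ne q 0 with rfl | h0
  · rw [tsum_eq_single 0]
    · rw [show (n : ℤ) - (0 : ℕ) = n by simp,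
        show (n : ℤ) + 1 + (0 : ℕ) = (n + 1 : ℕ) by simp, qpSqInv_natCast, qpSqInv_natCast]
      simp [pent, qpSq]
    · intro r hr
      have : (pent r).toNat ≠ 0 := by
        have h1 := two_mul_pent r
        have : (0 : ℤ) < r * (3 * r - 1) := mul_pos (by lia) (by lia)
        lia
      simp [zero_pow this]
  · obtain ⟨-, h1, h2⟩ := thetaSum_diag hq h0 n
    have key : thetaSum q n (n + 1) 0 = ∑' r : ℕ, (-1) ^ r * q ^ (pent r).toNat *
        (1 - q ^ (4 * r + 2)) * (qpSqInv q (n - r) * qpSqInv q (n + 1 + r)) := by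
      have hs := summable_thetaSum q n (n + 1) 0
      unfold thetaSum
      obtain ⟨f, hf⟩ : ∃ f : ℤ → ℂ, f = fun r : ℤ =>
        (-1) ^ r * q ^ (pent r + 0 * r) * qpSqInv q (n - r) * qpSqInv q (n + 1 + r) := ⟨_, rfl⟩
      rw [← hf] at hs ⊢
      have hN : Summable fun r : ℕ => f r := hs.comp_injective Nat.cast_injective
      have hZ : Summable fun r : ℕ => f (-(r + 1)) :=
        hs.comp_injective (i := fun r : ℕ => (-(r + 1) : ℤ)) fun a b h => by
          simp only at h; lia
      rw [tsum_of_nat_of_neg_add_one hN hZ, ← hN.tsum_add hZ]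
      congr 1 with r
      have e1 : q ^ (pent r) = q ^ (pent r).toNat := by
        rw [← zpow_natCast, coe_toNat_pent]
      have e2 : q ^ (pent (-(r + 1 : ℤ))) = q ^ (pent r).toNat * q ^ (4 * r + 2) := by
        rw [← pow_add, ← zpow_natCast, pent_neg, pent_add_one]
        congr 1
        push_cast
        rw [coe_toNat_pent]
        ring
      have e3 : (-1 : ℂ) ^ (-(r + 1 : ℤ)) = -(-1) ^ r := by
        rw [zpow_neg, ← inv_zpow, zpow_add_one₀ (by norm_num)]
        norm_num
      simp only [hf, zero_mul, add_zero, e1, e2, e3, zpow_natCast]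
      rw [show (n : ℤ) - -(r + 1) = n + 1 + r by ring, show (n : ℤ) + 1 + -(r + 1) = n - r by ring]
      ring
    rw [← key, h1]
    exact inv_eq_of_mul_eq_one_right (by linear_combination h2)

lemma summable_doubleTerm {q : ℂ} (hq : ‖q‖ < 1) :
    Summable (Function.uncurry (doubleTerm q)) := by
  obtain ⟨C, hC0, -, -, -, hC⟩ := exists_norm_qpSq_le hq
  have hI (k : ℤ) : ‖qpSqInv q k‖ ≤ C := by
    unfold qpSqInv
    split_ifs
    · simpa using hC0
    · exact (hC _).2
  have hg := summable_geometric_of_lt_one (norm_nonneg q) hq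
  refine Summable.of_norm_bounded ((hg.mul_of_nonneg hg (fun n => by positivity)
    (fun n => by positivity)).mul_left (2 * (C * C * C))) ?_
  rintro ⟨r, n⟩
  simp only [Function.uncurry_apply_pair]
  rcases lt_or_ge n r with h | h
  · rw [doubleTerm, qpSqInv_of_neg q (k := n - r) (by lia)]
    simp only [mul_zero, zero_mul, norm_zero]
    positivity
  · have h1 := (hC n).1
    have h2 := hI (n - r)
    have h3 := hI (n + 1 + r)
    have h4 : ‖1 - q ^ (4 * r + 2)‖ ≤ 2 := by
      refine (norm_sub_le _ _).trans ?_
      rw [norm_one, norm_pow]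
      linarith [pow_le_one₀ (n := 4 * r + 2) (norm_nonneg q) hq.le]
    have h5 : ‖q‖ ^ ((pent r).toNat + n * (n + 1)) ≤ ‖q‖ ^ (r + n) :=
      pow_le_pow_of_le_one (norm_nonneg q) hq.le (by nlinarith [Nat.le_mul_self n])
    calc ‖doubleTerm q r n‖ = ‖1 - q ^ (4 * r + 2)‖ *
          (‖qpSq q n‖ * ‖qpSqInv q (n - r)‖ * ‖qpSqInv q (n + 1 + r)‖) *
          ‖q‖ ^ ((pent r).toNat + n * (n + 1)) := by
          simp only [doubleTerm, norm_mul, norm_pow, norm_neg, norm_one, one_pow, pow_add]; ring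
      _ ≤ 2 * (C * C * C) * ‖q‖ ^ (r + n) := by gcongr
      _ = _ := by rw [pow_add]

lemma tsum_doubleTerm {q : ℂ} (hq : ‖q‖ < 1) (r : ℕ) :
    ∑' n, doubleTerm q r n = q ^ ((pent r).toNat + r * (r + 1)) * (1 - q ^ (4 * r + 2)) := by
  have hs : Summable (doubleTerm q r) := (summable_doubleTerm hq).prod_factor r
  have hG := qpSq_mul_tsum_gaussTerm hq r r
  have hG1 : ∑' m, gaussTerm q r r m = 1 := by
    rwa [mul_eq_left₀ (qpSq_ne_zero hq r)] at hG
  have hR (c : ℂ) : c = ∑' m, c * gaussTerm q r r m := by rw [tsum_mul_left, hG1, mul_one]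
  rw [← hs.sum_add_tsum_nat_add r, Finset.sum_eq_zero, zero_add, hR (_ * _)]
  · congr 1 with m
    unfold doubleTerm gaussTerm
    rw [show ((m + r : ℕ) : ℤ) - r = m by push_cast; ring,
      show ((m + r : ℕ) : ℤ) + 1 + r = (r + r + m + 1 : ℕ) by push_cast; ring, qpSqInv_natCast,
      qpSqInv_natCast, add_comm m r, pow_add (-1 : ℂ),
      show (r + m) * (r + m + 1) = r * (r + 1) + (m * (m + 1) + 2 * r * m) by ring,
      pow_add q (r * (r + 1)), pow_add q (pent r).toNat]
    have : (-1 : ℂ) ^ r * (-1) ^ r = 1 := by rw [← mul_pow]; norm_num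
    linear_combination (q ^ (pent r).toNat * (1 - q ^ (4 * r + 2)) * q ^ (r * (r + 1)) * (-1) ^ m *
      q ^ (m * (m + 1) + 2 * r * m) * qpSq q (r + m) * (qpSq q m)⁻¹ *
      (qpSq q (r + r + m + 1))⁻¹) * this
  · intro n hn
    rw [doubleTerm, qpSqInv_of_neg q (k := n - r) (by have := Finset.mem_range.mp hn; lia)]
    ring

lemma tsum_qHypergeometric {q : ℂ} (hq : ‖q‖ < 1) :
    ∑' n : ℕ, (-1 : ℂ) ^ n * q ^ (n * (n + 1)) /
        ∏ k ∈ Finset.range (2 * n), (1 + q ^ (k + 1)) =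
      ∑' r : ℕ, q ^ ((pent r).toNat + r * (r + 1)) * (1 - q ^ (4 * r + 2)) := by
  rw [← tsum_congr (tsum_doubleTerm hq), ← (summable_doubleTerm hq).tsum_comm]
  congr 1 with n
  rw [div_eq_mul_inv, inv_prod_one_add_eq_tsum hq, ← mul_assoc, ← tsum_mul_left]
  congr 1 with r
  rw [doubleTerm]
  ring

lemma summable_norm_qHypergeometric {q : ℂ} (hq : ‖q‖ < 1) :
    Summable fun n : ℕ => ‖(-1 : ℂ) ^ n * q ^ (n * (n + 1)) /
      ∏ k ∈ Finset.range (2 * n), (1 + q ^ (k + 1))‖ := by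
  have hg := summable_geometric_of_lt_one (norm_nonneg q) hq
  obtain ⟨C, hC0, -, -, -, hC⟩ := exists_norm_prod_one_add_le (f := fun k => q ^ (k + 1))
    (by simpa only [norm_pow] using (summable_nat_add_iff 1).mpr hg)
    fun n => one_add_pow_ne_zero hq (by lia)
  refine (hg.mul_left C).of_nonneg_of_le (fun _ => norm_nonneg _) fun n => ?_
  rw [div_eq_mul_inv, norm_mul, norm_mul, norm_pow, norm_neg, norm_one, one_pow, one_mul,
    norm_pow, mul_comm]
  exact mul_le_mul (hC _).2 (pow_le_pow_of_le_one (norm_nonneg q) hq.le (by nlinarith))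
    (by positivity) hC0

lemma summable_norm_eps20 {q : ℂ} (hq : ‖q‖ < 1) :
    Summable fun n : ℕ => ‖(eps20 (n + 1) : ℂ) * q ^ (((n + 1) ^ 2 - 1) / 40)‖ := by
  rw [← summable_nat_add_iff 10]
  refine (summable_geometric_of_lt_one (norm_nonneg q) hq).of_nonneg_of_le
    (fun _ => norm_nonneg _) fun n => ?_
  have h1 : ‖(eps20 (n + 10 + 1) : ℂ)‖ ≤ 1 := by unfold eps20; split_ifs <;> simp
  have h2 : n ≤ ((n + 10 + 1) ^ 2 - 1) / 40 := by
    rw [Nat.le_div_iff_mul_le (by norm_num)]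
    refine Nat.le_sub_one_of_lt ?_
    zify
    nlinarith [sq_nonneg ((n : ℤ) - 9)]
  rw [norm_mul, norm_pow]
  calc _ ≤ 1 * ‖q‖ ^ n := mul_le_mul h1
        (pow_le_pow_of_le_one (norm_nonneg q) hq.le h2) (by positivity) zero_le_one
    _ = _ := one_mul _

lemma tsum_eps20 {q : ℂ} (hq : ‖q‖ < 1) :
    ∑' n : ℕ, (eps20 (n + 1) : ℂ) * q ^ (((n + 1) ^ 2 - 1) / 40) =
      ∑' r : ℕ, q ^ ((pent r).toNat + r * (r + 1)) * (1 - q ^ (4 * r + 2)) := by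
  have hs := (summable_norm_eps20 hq).of_norm
  have hc (j : ℕ) := hs.comp_injective (i := fun m : ℕ => j + 10 * m) fun a b h => by
    simp only at h; lia
  have hz (j : ℕ) (hj : j % 10 ≠ 0 ∧ j % 10 ≠ 8) : ∑' m : ℕ, (eps20 (j + 10 * m + 1) : ℂ) *
      q ^ (((j + 10 * m + 1) ^ 2 - 1) / 40) = 0 := by
    refine (tsum_congr fun m => ?_).trans tsum_zero
    rw [show eps20 (j + 10 * m + 1) = 0 by
      unfold eps20; rw [if_neg (by lia), if_neg (by lia)]]
    simp
  rw [Nat.sumByResidueClasses hs 10]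
  change ∑ j : Fin 10, ∑' m : ℕ, (eps20 ((j : ℕ) + 10 * m + 1) : ℂ) *
      q ^ ((((j : ℕ) + 10 * m + 1) ^ 2 - 1) / 40) = _
  rw [Finset.sum_eq_add (0 : Fin 10) 8 (by decide)
    (fun j _ hj => hz j (by revert hj; revert j; decide)) (by simp) (by simp)]
  refine ((hc 0).tsum_add (hc 8)).symm.trans (tsum_congr fun r => ?_)
  have h1 : eps20 (0 + 10 * r + 1) = 1 := by unfold eps20; rw [if_pos (by lia)]
  have h2 : eps20 (8 + 10 * r + 1) = -1 := by
    unfold eps20; rw [if_neg (by lia), if_pos (by lia)]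
  have hp := two_mul_pent r
  rw [← coe_toNat_pent] at hp
  have e1 : ((0 + 10 * r + 1) ^ 2 - 1) / 40 = (pent r).toNat + r * (r + 1) := by
    have : (0 + 10 * r + 1) ^ 2 = 40 * ((pent r).toNat + r * (r + 1)) + 1 := by
      zify; linear_combination (-20 : ℤ) * hp
    lia
  have e2 : ((8 + 10 * r + 1) ^ 2 - 1) / 40 = (pent r).toNat + r * (r + 1) + (4 * r + 2) := by
    have : (8 + 10 * r + 1) ^ 2 = 40 * ((pent r).toNat + r * (r + 1) + (4 * r + 2)) + 1 := by
      zify; linear_combination (-20 : ℤ) * hp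
    lia
  simp only [Function.comp_apply, h1, h2, e1, e2, pow_add q ((pent r).toNat + r * (r + 1))]
  push_cast
  ring

/-- the false theta function `q^{−1/40}Ψ^{10+2}_1` as a
`q`-hypergeometric series:
`Σ_{n≥1} ε₂₀(n) q^{(n²−1)/40} = Σ_{n≥0} (−1)ⁿ q^{n(n+1)}/(−q;q)_{2n}`. -/
theorem falseTheta_10_2_qHypergeometric (q : ℂ) (hq : ‖q‖ < 1) :
    (Summable fun n : ℕ =>
      ‖(eps20 (n + 1) : ℂ) * q ^ (((n + 1) ^ 2 - 1) / 40)‖) ∧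
    (Summable fun n : ℕ =>
      ‖(-1 : ℂ) ^ n * q ^ (n * (n + 1)) /
        ∏ k ∈ Finset.range (2 * n), (1 + q ^ (k + 1))‖) ∧
    ∑' n : ℕ, (eps20 (n + 1) : ℂ) * q ^ (((n + 1) ^ 2 - 1) / 40) =
      ∑' n : ℕ, (-1 : ℂ) ^ n * q ^ (n * (n + 1)) /
        ∏ k ∈ Finset.range (2 * n), (1 + q ^ (k + 1)) := by
  exact ⟨summable_norm_eps20 hq, summable_norm_qHypergeometric hq,
    (tsum_eps20 hq).trans (tsum_qHypergeometric hq).symm⟩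
end
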